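/- arXiv:math/0610796 — 2 statements merged into one kernel-verified Lean document; each statement's English description precedes it below -/
import Mathlib

section
/- Let U be a domain in ℝ^m, fix a ∈ ℝ, and fix for each compact subset K ⊆ U a constant M_K > 0. Then the family E of all harmonic functions f on U satisfying: for every compact K ⊆ U and every x ∈ K with f(x) = a, one has |∇f(x)| ≤ M_K — is a normal family. -/
open Filter Topology Metric

noncomputable section

/-- `ℝ^m` with the Euclidean structure. -/
abbrev E (m : ℕ) := EuclideanSpace ℝ (Fin m)

/-- The Laplacian of `f` at `x`. -/
noncomputable def lap {m : ℕ} (f : E m → ℝ) (x : E m) : ℝ :=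
  ∑ i, fderiv ℝ (fun y => fderiv ℝ f y (EuclideanSpace.single i 1)) x (EuclideanSpace.single i 1)

/-- `f` is harmonic on `U`: real-valued, `C²` with vanishing Laplacian. -/
def HarmOn {m : ℕ} (U : Set (E m)) (f : E m → ℝ) : Prop :=
  ContDiffOn ℝ 2 f U ∧ ∀ x ∈ U, lap f x = 0

/-- `f̃ x = |∇f(x)| / cosh (f x)`. -/
noncomputable def tilde {m : ℕ} (f : E m → ℝ) (x : E m) : ℝ :=
  ‖gradient f x‖ / Real.cosh (f x)

/-- `S(x) = arctan (sinh x)`, extended to `[-∞,+∞]` by `S(±∞) = ±π/2`.  The distance on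
`[-∞,+∞]` is `d(x,y) = |S x - S y|`. -/
noncomputable def SF : EReal → ℝ := fun x =>
  if x = ⊤ then Real.pi / 2 else if x = ⊥ then -(Real.pi / 2)
  else Real.arctan (Real.sinh x.toReal)

/-- Uniform convergence on every compact subset of `U`, with respect to the distance
`d(x,y) = |S x - S y|` on `[-∞,+∞]`. -/
def TendstoCptsE {m : ℕ} (U : Set (E m)) (g : ℕ → E m → EReal) (G : E m → EReal) : Prop :=
  ∀ K ⊆ U, IsCompact K → ∀ ε > 0, ∃ N : ℕ, ∀ n ≥ N, ∀ x ∈ K, |SF (g n x) - SF (G x)| < ε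

/-- A family `Fam` of harmonic functions on `U` is normal if every sequence in `Fam` has a
subsequence converging uniformly on compact subsets of `U` either to a harmonic function on
`U`, or to the constant `+∞`, or to the constant `-∞`. -/
def NormalFam {m : ℕ} (U : Set (E m)) (Fam : Set (E m → ℝ)) : Prop :=
  ∀ f : ℕ → E m → ℝ, (∀ n, f n ∈ Fam) →
    ∃ φ : ℕ → ℕ, StrictMono φ ∧
      ((∃ g : E m → ℝ, HarmOn U g ∧
          TendstoCptsE U (fun k x => ((f (φ k) x : ℝ) : EReal)) (fun x => ((g x : ℝ) : EReal)))
       ∨ TendstoCptsE U (fun k x => ((f (φ k) x : ℝ) : EReal)) (fun _ => (⊤ : EReal))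
       ∨ TendstoCptsE U (fun k x => ((f (φ k) x : ℝ) : EReal)) (fun _ => (⊥ : EReal)))



open MeasureTheory in
/-- antiderivative of the radial profile -/
def Psi (ψ : ℝ → ℝ) (s : ℝ) : ℝ := (1/2) * ∫ u in (1:ℝ)..s, ψ u

lemma Psi_hasDerivAt {ψ : ℝ → ℝ} (hψ : Continuous ψ) (s : ℝ) :
    HasDerivAt (Psi ψ) (ψ s / 2) s := by
  have := (intervalIntegral.integral_hasDerivAt_right (hψ.intervalIntegrable 1 s)
    (hψ.stronglyMeasurableAtFilter _ _) hψ.continuousAt).const_mul (1/2 : ℝ)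
  exact this.congr_deriv (by ring)

lemma Psi_zero {ψ : ℝ → ℝ} (h0 : ∀ s, 1 ≤ s → ψ s = 0) {s : ℝ} (hs : 1 ≤ s) : Psi ψ s = 0 := by
  unfold Psi
  rw [intervalIntegral.integral_congr (g := fun _ => (0:ℝ))]
  · simp
  · intro u hu
    rw [Set.uIcc_of_le hs] at hu
    exact h0 u hu.1

lemma Psi_continuous {ψ : ℝ → ℝ} (hψ : Continuous ψ) : Continuous (Psi ψ) :=
  continuous_iff_continuousAt.2 fun s => (Psi_hasDerivAt hψ s).continuousAt

lemma radial_hcs {m : ℕ} {χ : ℝ → ℝ} (h0 : ∀ s, 1 ≤ s → χ s = 0) :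
    HasCompactSupport (fun y : E m => χ (‖y‖^2)) := by
  refine HasCompactSupport.intro (isCompact_closedBall (0 : E m) 1) fun y hy => h0 _ ?_
  simp only [mem_closedBall, dist_zero_right, not_le] at hy
  nlinarith

lemma radial_cont {m : ℕ} {χ : ℝ → ℝ} (h : Continuous χ) :
    Continuous (fun y : E m => χ (‖y‖^2)) := by fun_prop

lemma Psi_radial_fderiv {m : ℕ} {ψ : ℝ → ℝ} (hψ : Continuous ψ) (y : E m) :
    HasFDerivAt (fun y : E m => Psi ψ (‖y‖^2)) (ψ (‖y‖^2) • (innerSL ℝ y)) y := by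
  have h1 := (hasStrictFDerivAt_norm_sq y).hasFDerivAt
  have := (Psi_hasDerivAt hψ (‖y‖^2)).comp_hasFDerivAt y h1
  refine this.congr_fderiv ?_
  ext v
  simp
  ring

lemma sum_coord {m : ℕ} (L : E m →L[ℝ] ℝ) (y : E m) :
    L y = ∑ i, L (EuclideanSpace.single i 1) * y i := by
  conv_lhs => rw [← (EuclideanSpace.basisFun (Fin m) ℝ).sum_repr y]
  simp [mul_comm]

lemma contDiff_partial {m : ℕ} {F : E m → ℝ} (hF : ContDiff ℝ 2 F) (v : E m) :
    ContDiff ℝ 1 (fun y => fderiv ℝ F y v) :=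
  (hF.fderiv_right (m := 1) (by norm_num)).clm_apply contDiff_const

lemma lap_cont {m : ℕ} {F : E m → ℝ} (hF : ContDiff ℝ 2 F) : Continuous (lap F) := by
  unfold lap
  refine continuous_finsetSum _ fun i _ => ?_
  exact ((contDiff_partial hF _).continuous_fderiv (by norm_num)).clm_apply continuous_const

open MeasureTheory in
lemma by_parts {m : ℕ} {F : E m → ℝ} (hF : ContDiff ℝ 2 F)
    {ψ : ℝ → ℝ} (hψ : Continuous ψ) (h0 : ∀ s, 1 ≤ s → ψ s = 0) (x : E m) (t : ℝ) :
    ∫ y : E m, fderiv ℝ F (x + t • y) y * ψ (‖y‖^2) =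
      - (t * ∫ y : E m, lap F (x + t • y) * Psi ψ (‖y‖^2)) := by
  have hcont : Continuous (fun y : E m => x + t • y) := by fun_prop
  have hΨc : Continuous (fun y : E m => Psi ψ (‖y‖^2)) := radial_cont (Psi_continuous hψ)
  have hψc : Continuous (fun y : E m => ψ (‖y‖^2)) := radial_cont hψ
  have hΨs : HasCompactSupport (fun y : E m => Psi ψ (‖y‖^2)) :=
    radial_hcs fun s hs => Psi_zero h0 hs
  have hψs : HasCompactSupport (fun y : E m => ψ (‖y‖^2)) := radial_hcs h0
  let e : Fin m → E m := fun i => EuclideanSpace.single i 1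
  have hp : ∀ i, ContDiff ℝ 1 (fun y : E m => fderiv ℝ F (x + t • y) (e i)) := fun i =>
    (contDiff_partial hF (e i)).comp (by fun_prop)
  have hpd : ∀ i y, fderiv ℝ (fun y : E m => fderiv ℝ F (x + t • y) (e i)) y (e i)
      = t * fderiv ℝ (fun z => fderiv ℝ F z (e i)) (x + t • y) (e i) := by
    intro i y
    have h1 : HasFDerivAt (fun y : E m => x + t • y) (t • ContinuousLinearMap.id ℝ (E m)) y :=
      ((hasFDerivAt_id y).const_smul t).const_add x
    have h2 := (((contDiff_partial hF (e i)).differentiable (by norm_num)) (x + t • y)).hasFDerivAt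
    have h3 := h2.comp y h1
    have := h3.fderiv
    rw [Function.comp_def] at this
    rw [this]
    simp
  have hΨd : ∀ i y, fderiv ℝ (fun y : E m => Psi ψ (‖y‖^2)) y (e i) = y i * ψ (‖y‖^2) := by
    intro i y
    rw [(Psi_radial_fderiv hψ y).fderiv]
    simp [e, EuclideanSpace.inner_single_right, mul_comm]
  have hpc : ∀ i, Continuous fun y : E m => fderiv ℝ (fun z => fderiv ℝ F z (e i)) (x + t • y) (e i) :=
    fun i => (((contDiff_partial hF (e i)).continuous_fderiv (by norm_num)).clm_apply
      continuous_const).comp hcont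
  have key : ∀ i, ∫ y : E m, fderiv ℝ F (x + t • y) (e i) * (y i * ψ (‖y‖^2)) =
      - (t * ∫ y : E m, fderiv ℝ (fun z => fderiv ℝ F z (e i)) (x + t • y) (e i) * Psi ψ (‖y‖^2)) := by
    intro i
    have := integral_mul_fderiv_eq_neg_fderiv_mul_of_integrable (μ := (volume : Measure (E m)))
      (f := fun y : E m => fderiv ℝ F (x + t • y) (e i))
      (g := fun y : E m => Psi ψ (‖y‖^2)) (v := e i) ?_ ?_ ?_ ?_ ?_
    · simp only [hΨd, hpd] at this
      rw [this, ← integral_const_mul]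
      simp only [mul_assoc]
    · simp only [hpd]
      refine Continuous.integrable_of_hasCompactSupport ?_ hΨs.mul_left
      exact (continuous_const.mul (hpc i)).mul hΨc
    · simp only [hΨd]
      refine Continuous.integrable_of_hasCompactSupport ?_ (hψs.mul_left.mul_left)
      exact (hp i).continuous.mul (((EuclideanSpace.proj i : E m →L[ℝ] ℝ).continuous).mul hψc)
    · refine Continuous.integrable_of_hasCompactSupport ?_ hΨs.mul_left
      exact (hp i).continuous.mul hΨc
    · exact fun y _ => ((hp i).differentiable (by norm_num)) y
    · exact fun y _ => (Psi_radial_fderiv hψ y).differentiableAt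
  have hl : ∀ y : E m, fderiv ℝ F (x + t • y) y * ψ (‖y‖^2) =
      ∑ i, fderiv ℝ F (x + t • y) (e i) * (y i * ψ (‖y‖^2)) := by
    intro y
    rw [sum_coord (fderiv ℝ F (x + t • y)) y, Finset.sum_mul]
    simp only [mul_assoc, e]
  have hr : ∀ y : E m, lap F (x + t • y) * Psi ψ (‖y‖^2) =
      ∑ i, fderiv ℝ (fun z => fderiv ℝ F z (e i)) (x + t • y) (e i) * Psi ψ (‖y‖^2) := by
    intro y
    unfold lap
    rw [Finset.sum_mul]
  simp only [hl, hr]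
  rw [integral_finsetSum, integral_finsetSum, Finset.mul_sum, ← Finset.sum_neg_distrib]
  · exact Finset.sum_congr rfl fun i _ => key i
  · intro i _
    refine Continuous.integrable_of_hasCompactSupport ?_ hΨs.mul_left
    exact (hpc i).mul hΨc
  · intro i _
    refine Continuous.integrable_of_hasCompactSupport ?_ (hψs.mul_left.mul_left)
    exact (hp i).continuous.mul (((EuclideanSpace.proj i : E m →L[ℝ] ℝ).continuous).mul hψc)

open MeasureTheory in
lemma mean_deriv {m : ℕ} {F : E m → ℝ} (hF : ContDiff ℝ 2 F) (hFs : HasCompactSupport F)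
    {ψ : ℝ → ℝ} (hψ : Continuous ψ) (h0 : ∀ s, 1 ≤ s → ψ s = 0) (x : E m) (t : ℝ) :
    HasDerivAt (fun t : ℝ => ∫ y : E m, F (x + t • y) * ψ (‖y‖^2))
      (- (t * ∫ y : E m, lap F (x + t • y) * Psi ψ (‖y‖^2))) t := by
  have hψc : Continuous (fun y : E m => ψ (‖y‖^2)) := radial_cont hψ
  have hψs : HasCompactSupport (fun y : E m => ψ (‖y‖^2)) := radial_hcs h0
  rw [← by_parts hF hψ h0]
  obtain ⟨C, hC⟩ := (hFs.fderiv ℝ).exists_bound_of_continuous (hF.continuous_fderiv (by norm_num))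
  have hi : ∀ t : ℝ, Integrable (fun y : E m => F (x + t • y) * ψ (‖y‖^2)) := fun t =>
    Continuous.integrable_of_hasCompactSupport
      ((hF.continuous.comp (by fun_prop)).mul hψc) hψs.mul_left
  refine (hasDerivAt_integral_of_dominated_loc_of_deriv_le (s := Set.univ)
    (F := fun (t : ℝ) (y : E m) => F (x + t • y) * ψ (‖y‖^2))
    (F' := fun (t : ℝ) (y : E m) => fderiv ℝ F (x + t • y) y * ψ (‖y‖^2))
    (bound := fun y : E m => C * ‖y‖ * |ψ (‖y‖^2)|) univ_mem ?_ (hi t) ?_ ?_ ?_ ?_).2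
  · exact Eventually.of_forall fun t => (hi t).aestronglyMeasurable
  · refine Continuous.aestronglyMeasurable ?_
    exact (((hF.continuous_fderiv (by norm_num)).comp (by fun_prop)).clm_apply continuous_id).mul hψc
  · refine Eventually.of_forall fun y t _ => ?_
    rw [norm_mul, Real.norm_eq_abs (ψ _)]
    gcongr
    exact (ContinuousLinearMap.le_opNorm _ _).trans (by gcongr; exact hC _)
  · refine Continuous.integrable_of_hasCompactSupport ?_ ?_
    · exact (continuous_const.mul continuous_norm).mul hψc.abs
    · exact (hψs.comp_left (g := fun s => |s|) (by simp)).mul_left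
  · refine Eventually.of_forall fun y t _ => ?_
    have h1 : HasDerivAt (fun t : ℝ => x + t • y) y t := by
      simpa using ((hasDerivAt_id t).smul_const y).const_add x
    have h2 := ((hF.differentiable (by norm_num)) (x + t • y)).hasFDerivAt
    exact (h2.comp_hasDerivAt t h1).mul_const _


lemma lap_congr {m : ℕ} {f g : E m → ℝ} {x : E m} (h : f =ᶠ[𝓝 x] g) : lap f x = lap g x := by
  unfold lap
  refine Finset.sum_congr rfl fun i _ => ?_
  have : (fun y => fderiv ℝ f y (EuclideanSpace.single i 1)) =ᶠ[𝓝 x]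
      (fun y => fderiv ℝ g y (EuclideanSpace.single i 1)) := by
    filter_upwards [h.eventuallyEq_nhds] with y hy
    rw [hy.fderiv_eq]
  rw [this.fderiv_eq]

lemma HarmOn.mono {m : ℕ} {f : E m → ℝ} {U V : Set (E m)} (h : HarmOn U f) (hV : V ⊆ U) :
    HarmOn V f := ⟨h.1.mono hV, fun x hx => h.2 x (hV hx)⟩

lemma HarmOn.neg {m : ℕ} {f : E m → ℝ} {U : Set (E m)} (h : HarmOn U f) :
    HarmOn U (fun x => - f x) := by
  refine ⟨h.1.neg, fun x hx => ?_⟩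
  have := h.2 x hx
  unfold lap at this ⊢
  simp only [fderiv_fun_neg, neg_apply, Finset.sum_neg_distrib, this, neg_zero]

lemma HarmOn.sub_const {m : ℕ} {f : E m → ℝ} {U : Set (E m)} (h : HarmOn U f) (a : ℝ) :
    HarmOn U (fun x => f x - a) := by
  refine ⟨h.1.sub contDiffOn_const, fun x hx => ?_⟩
  have := h.2 x hx
  unfold lap at this ⊢
  simpa only [fderiv_sub_const] using this

lemma exists_ext {m : ℕ} {f : E m → ℝ} {x : E m} {r R : ℝ} (hr : 0 < r) (hR : r < R)
    (hf : ContDiffOn ℝ 2 f (ball x R)) :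
    ∃ F : E m → ℝ, ContDiff ℝ 2 F ∧ HasCompactSupport F ∧ ∀ y ∈ ball x r, F y = f y := by
  let χ : ContDiffBump x := ⟨r, (r + R) / 2, hr, by linarith⟩
  refine ⟨fun y => χ y * f y, ?_, χ.hasCompactSupport.mul_right, ?_⟩
  · rw [contDiff_iff_contDiffAt]
    intro y
    by_cases hy : y ∈ ball x R
    · exact χ.contDiff.contDiffAt.mul (hf.contDiffAt (isOpen_ball.mem_nhds hy))
    · have : (fun y => χ y * f y) =ᶠ[𝓝 y] fun _ => 0 := by
        have : (closedBall x ((r+R)/2))ᶜ ∈ 𝓝 y := by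
          refine isClosed_closedBall.isOpen_compl.mem_nhds ?_
          simp only [mem_ball, not_lt, Set.mem_compl_iff, mem_closedBall, not_le] at hy ⊢
          linarith
        filter_upwards [this] with z hz
        rw [χ.zero_of_le_dist, zero_mul]
        simp only [Set.mem_compl_iff, mem_closedBall, not_le] at hz
        exact hz.le
      exact contDiffAt_const.congr_of_eventuallyEq this
  · intro y hy
    show χ y * f y = f y
    rw [χ.one_of_mem_closedBall (ball_subset_closedBall hy), one_mul]

lemma mem_ball_aux {m : ℕ} {x y : E m} {t r : ℝ} (ht : 0 ≤ t) (htr : t < r) (hy : ‖y‖ ≤ 1) :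
    x + t • y ∈ ball x r := by
  rw [mem_ball, dist_eq_norm, add_sub_cancel_left, norm_smul, Real.norm_of_nonneg ht]
  nlinarith

lemma radial_out {m : ℕ} {y : E m} (hy : ¬ ‖y‖ ≤ 1) : 1 ≤ ‖y‖^2 := by
  push Not at hy
  nlinarith

open MeasureTheory in
/-- Mean value property against radial kernels. -/
lemma mvp {m : ℕ} {f : E m → ℝ} {x : E m} {R : ℝ} (hf : HarmOn (ball x R) f)
    {ψ : ℝ → ℝ} (hψ : Continuous ψ) (h0 : ∀ s, 1 ≤ s → ψ s = 0) {t : ℝ} (ht : 0 ≤ t) (htR : t < R) :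
    ∫ y : E m, f (x + t • y) * ψ (‖y‖^2) = f x * ∫ y : E m, ψ (‖y‖^2) := by
  obtain ⟨r, htr, hrR⟩ := exists_between htR
  have hr : 0 < r := by linarith
  obtain ⟨F, hF, hFs, hFf⟩ := exists_ext hr hrR hf.1
  have hd : ∀ s ∈ Set.Icc 0 t, HasDerivAt (fun t : ℝ => ∫ y : E m, F (x + t • y) * ψ (‖y‖^2)) 0 s := by
    intro s hs
    have := mean_deriv hF hFs hψ h0 x s
    refine this.congr_deriv ?_
    have h : ∀ y : E m, lap F (x + s • y) * Psi ψ (‖y‖^2) = 0 := by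
      intro y
      by_cases hy : ‖y‖ ≤ 1
      · have hm := mem_ball_aux (x := x) hs.1 (lt_of_le_of_lt hs.2 htr) hy
        have : F =ᶠ[𝓝 (x + s • y)] f := by
          filter_upwards [isOpen_ball.mem_nhds hm] with z hz using hFf z hz
        rw [lap_congr this, hf.2 _ (ball_subset_ball hrR.le hm), zero_mul]
      · rw [Psi_zero h0 (radial_out hy), mul_zero]
    simp [h]
  have hc := constant_of_has_deriv_right_zero
    (fun s hs => (hd s hs).continuousAt.continuousWithinAt)
    (fun s hs => (hd s (Set.Ico_subset_Icc_self hs)).hasDerivWithinAt) t (Set.right_mem_Icc.2 ht)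
  have e1 : ∫ y : E m, f (x + t • y) * ψ (‖y‖^2) = ∫ y : E m, F (x + t • y) * ψ (‖y‖^2) := by
    congr 1
    ext y
    by_cases hy : ‖y‖ ≤ 1
    · rw [hFf _ (mem_ball_aux ht htr hy)]
    · rw [h0 _ (radial_out hy), mul_zero, mul_zero]
  rw [e1, hc]
  simp only [zero_smul, add_zero]
  rw [integral_const_mul, hFf x (mem_ball_self hr)]

/-- profiles -/
def psi1 (s : ℝ) : ℝ := Real.smoothTransition (1/9 - s)
def psi2 (s : ℝ) : ℝ := Real.smoothTransition (2 * (1 - s))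

lemma psi1_cont : Continuous psi1 :=
  Real.smoothTransition.continuous.comp (by fun_prop)
lemma psi2_contDiff {n : ℕ∞} : ContDiff ℝ n psi2 :=
  Real.smoothTransition.contDiff.comp (by fun_prop)
lemma psi2_cont : Continuous psi2 :=
  Real.smoothTransition.continuous.comp (by fun_prop)
lemma psi1_zero' {s : ℝ} (h : 1/9 ≤ s) : psi1 s = 0 :=
  Real.smoothTransition.zero_of_nonpos (by linarith)
lemma psi1_zero : ∀ s, 1 ≤ s → psi1 s = 0 := fun s h => psi1_zero' (by linarith)
lemma psi2_zero : ∀ s, 1 ≤ s → psi2 s = 0 := fun s h =>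
  Real.smoothTransition.zero_of_nonpos (by linarith)
lemma psi1_nonneg (s : ℝ) : 0 ≤ psi1 s := Real.smoothTransition.nonneg _
lemma psi2_nonneg (s : ℝ) : 0 ≤ psi2 s := Real.smoothTransition.nonneg _
lemma psi1_le_one (s : ℝ) : psi1 s ≤ 1 := Real.smoothTransition.le_one _
lemma psi2_one {s : ℝ} (h : s ≤ 1/2) : psi2 s = 1 :=
  Real.smoothTransition.one_of_one_le (by linarith)

open MeasureTheory in
lemma radial_int_pos {m : ℕ} {ψ : ℝ → ℝ} (hψ : Continuous ψ) (h0 : ∀ s, 1 ≤ s → ψ s = 0)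
    (hn : ∀ s, 0 ≤ ψ s) (hp : ψ 0 ≠ 0) : 0 < ∫ y : E m, ψ (‖y‖^2) :=
  (radial_cont hψ).integral_pos_of_hasCompactSupport_nonneg_nonzero (radial_hcs h0)
    (fun y => hn _) (x := 0) (by simpa using hp)

lemma psi1_int (m : ℕ) : 0 < ∫ y : E m, psi1 (‖y‖^2) :=
  radial_int_pos psi1_cont psi1_zero psi1_nonneg
    (Real.smoothTransition.pos_of_pos (by norm_num)).ne'
lemma psi2_int (m : ℕ) : 0 < ∫ y : E m, psi2 (‖y‖^2) :=
  radial_int_pos psi2_cont psi2_zero psi2_nonneg (by rw [psi2_one (by norm_num)]; norm_num)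

open MeasureTheory in
/-- translating the centre -/
lemma mvp_shift {m : ℕ} {f : E m → ℝ} {x z : E m} {R : ℝ} (hf : HarmOn (ball z R) f)
    {ψ : ℝ → ℝ} (hψ : Continuous ψ) (h0 : ∀ s, 1 ≤ s → ψ s = 0) {t : ℝ} (ht : 0 < t) (htR : t < R) :
    ∫ y : E m, f (x + t • y) * ψ (‖y + t⁻¹ • (x - z)‖^2) = f z * ∫ y : E m, ψ (‖y‖^2) := by
  rw [← mvp hf hψ h0 ht.le htR]
  rw [← integral_add_right_eq_self (fun y : E m => f (z + t • y) * ψ (‖y‖^2)) (t⁻¹ • (x - z))]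
  congr 1
  ext y
  congr 2
  rw [smul_add, smul_inv_smul₀ ht.ne']
  abel

open MeasureTheory in
lemma integrable_aux {m : ℕ} {f : E m → ℝ} {x : E m} {R : ℝ} (hf : ContinuousOn f (ball x R))
    {φ : E m → ℝ} (hφ : Continuous φ) {t r : ℝ} (h0 : ∀ y, r < ‖y‖ → φ y = 0)
    (ht : 0 ≤ t) (htR : t * r < R) :
    Integrable (fun y : E m => f (x + t • y) * φ y) := by
  have hK : IsCompact (closedBall (0 : E m) r) := isCompact_closedBall _ _
  have : IntegrableOn (fun y : E m => f (x + t • y) * φ y) (closedBall (0 : E m) r) := by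
    refine ContinuousOn.integrableOn_compact hK ?_
    have hmap : Set.MapsTo (fun y : E m => x + t • y) (closedBall (0 : E m) r) (ball x R) := ?_
    · exact (hf.comp (by fun_prop) hmap).mul hφ.continuousOn
    intro y hy
    rw [mem_ball, dist_eq_norm, add_sub_cancel_left, norm_smul, Real.norm_of_nonneg ht]
    have := mem_closedBall_zero_iff.1 hy
    nlinarith
  refine (integrableOn_iff_integrable_of_support_subset ?_).1 this
  intro y hy
  by_contra hc
  apply hy
  simp only [mem_closedBall, dist_zero_right, not_le] at hc
  simp only [h0 y hc, mul_zero]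

open MeasureTheory in
lemma harnack_one {m : ℕ} {f : E m → ℝ} {x z : E m} {R t : ℝ} (hf : HarmOn (ball x R) f)
    (hpos : ∀ w ∈ ball x R, 0 ≤ f w) (ht : 0 < t) (htR : 2 * t ≤ R) (hz : dist z x ≤ t / 3) :
    f z * (∫ y : E m, psi1 (‖y‖^2)) ≤ f x * ∫ y : E m, psi2 (‖y‖^2) := by
  have hfz : HarmOn (ball z (2 * t - t / 3)) f := hf.mono (ball_subset_ball' (by linarith))
  rw [← mvp_shift (x := x) hfz psi1_cont psi1_zero ht (by linarith),
    ← mvp hf psi2_cont psi2_zero ht.le (by linarith)]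
  have hn : ‖t⁻¹ • (x - z)‖ ≤ 1 / 3 := by
    rw [norm_smul, norm_inv, Real.norm_of_nonneg ht.le, ← dist_eq_norm, dist_comm,
      inv_mul_le_iff₀ ht]
    linarith
  have hle : ∀ y : E m, ‖y‖ - 1/3 ≤ ‖y + t⁻¹ • (x - z)‖ := by
    intro y
    have := norm_sub_le (y + t⁻¹ • (x - z)) (t⁻¹ • (x - z))
    rw [add_sub_cancel_right] at this
    linarith
  have hz0 : ∀ y : E m, 2/3 < ‖y‖ → psi1 (‖y + t⁻¹ • (x - z)‖^2) = 0 := by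
    intro y hy
    refine psi1_zero' ?_
    have := hle y
    nlinarith
  refine integral_mono (integrable_aux (r := 1) hf.1.continuousOn ?_ ?_ ht.le (by linarith))
    (integrable_aux (r := 1) hf.1.continuousOn (radial_cont psi2_cont) ?_ ht.le (by linarith)) ?_
  · exact psi1_cont.comp (by fun_prop)
  · intro y hy
    exact hz0 y (by linarith)
  · intro y hy
    exact psi2_zero _ (radial_out (not_le.2 hy))
  · intro y
    simp only
    by_cases hy : ‖y‖ ≤ 1
    · refine mul_le_mul_of_nonneg_left ?_ (hpos _ (mem_ball_aux ht.le (by linarith) hy))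
      by_cases hy2 : 2/3 < ‖y‖
      · rw [hz0 y hy2]; exact psi2_nonneg _
      · rw [psi2_one]
        · exact psi1_le_one _
        · have := norm_nonneg y
          nlinarith
    · rw [hz0 y (by linarith), psi2_zero _ (radial_out hy)]

/-- Harnack inequality -/
lemma harnack (m : ℕ) : ∃ C : ℝ, 0 < C ∧ ∀ (f : E m → ℝ) (x : E m) (R : ℝ), 0 < R →
    HarmOn (ball x R) f → (∀ w ∈ ball x R, 0 ≤ f w) → ∀ z, dist z x ≤ R / 9 →
    f z ≤ C * f x ∧ f x ≤ C * f z := by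
  have h1 := psi1_int m
  have h2 := psi2_int m
  refine ⟨(∫ y : E m, psi2 (‖y‖^2)) / (∫ y : E m, psi1 (‖y‖^2)), by positivity, ?_⟩
  intro f x R hR hf hpos z hz
  have hb : ball z (2 * (R/3)) ⊆ ball x R := ball_subset_ball' (by linarith)
  have a1 := harnack_one (t := R / 3) hf hpos (by linarith) (by linarith) (z := z) (by linarith)
  have a2 := harnack_one (t := R / 3) (hf.mono hb) (fun w hw => hpos w (hb hw)) (by linarith)
    (by linarith) (z := x) (by rw [dist_comm]; linarith)
  constructor
  · rw [div_mul_eq_mul_div, le_div_iff₀ h1]; linarith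
  · rw [div_mul_eq_mul_div, le_div_iff₀ h1]; linarith


lemma lap_nonneg_of_min {m : ℕ} {w : E m → ℝ} {z : E m} (hw : ContDiffAt ℝ 2 w z)
    (hmin : IsLocalMin w z) : 0 ≤ lap w z := by
  unfold lap
  refine Finset.sum_nonneg fun i _ => ?_
  by_contra hneg
  push Not at hneg
  set e : E m := EuclideanSpace.single i 1
  have hline : ∀ s : ℝ, HasDerivAt (fun s : ℝ => z + s • e) e s := fun s => by
    simpa using ((hasDerivAt_id s).smul_const e).const_add z
  have hcont : ContinuousAt (fun s : ℝ => z + s • e) 0 := (hline 0).continuousAt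
  have htend : Tendsto (fun s : ℝ => z + s • e) (𝓝 0) (𝓝 z) := by
    simpa [ContinuousAt] using hcont
  set g : ℝ → ℝ := fun s => w (z + s • e) with hg
  have hev : ∀ᶠ y in 𝓝 z, ContDiffAt ℝ 2 w y := hw.eventually (by simp)
  have hd1 : deriv g =ᶠ[𝓝 0] fun s => fderiv ℝ w (z + s • e) e := by
    filter_upwards [htend.eventually hev] with s hs
    exact ((hs.differentiableAt (by norm_num)).hasFDerivAt.comp_hasDerivAt s (hline s)).deriv
  have hd2 : deriv (deriv g) 0 = fderiv ℝ (fun y => fderiv ℝ w y e) z e := by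
    rw [hd1.deriv_eq]
    have h1 : DifferentiableAt ℝ (fun y => fderiv ℝ w y e) (z + (0:ℝ) • e) := by
      rw [zero_smul, add_zero]
      exact ((hw.fderiv_right (m := 1) (by norm_num)).differentiableAt (by norm_num)).clm_apply
        (differentiableAt_const e)
    have := (h1.hasFDerivAt.comp_hasDerivAt (0:ℝ) (hline 0)).deriv
    rw [Function.comp_def] at this
    rw [this]; simp
  have hgmin : IsLocalMin g 0 := by
    have := htend.eventually hmin
    filter_upwards [this] with s hs
    simpa [hg] using hs
  have hgd : deriv g 0 = 0 := hgmin.deriv_eq_zero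
  have hgc : ContinuousAt g 0 := by
    have h1 : ContinuousAt w (z + (0:ℝ) • e) := by simpa using hw.continuousAt
    exact h1.comp (f := fun s : ℝ => z + s • e) hcont
  have hgmax := isLocalMax_of_deriv_deriv_neg (by rw [hd2]; exact hneg) hgd hgc
  have hconst : g =ᶠ[𝓝 0] fun _ => g 0 := by
    filter_upwards [hgmin, hgmax] with s h1 h2 using le_antisymm h2 h1
  have h3 : deriv g =ᶠ[𝓝 0] fun _ => 0 := by
    filter_upwards [hconst.eventuallyEq_nhds] with s hs
    rw [hs.deriv_eq]; simp
  have : deriv (deriv g) 0 = 0 := by rw [h3.deriv_eq]; simp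
  rw [hd2] at this
  linarith

/-- the barrier -/
def bar {m : ℕ} (α : ℝ) (x z : E m) : ℝ := Real.exp (-α * ‖z - x‖^2)

lemma bar_contDiff {m : ℕ} (α : ℝ) (x : E m) : ContDiff ℝ 2 (bar α x) := by
  unfold bar
  exact Real.contDiff_exp.comp (contDiff_const.mul ((contDiff_id.sub contDiff_const).norm_sq ℝ))

lemma bar_fderiv {m : ℕ} (α : ℝ) (x z : E m) :
    HasFDerivAt (bar α x) ((-2 * α * bar α x z) • innerSL ℝ (z - x)) z := by
  have h0 : HasFDerivAt (fun z : E m => z - x) (ContinuousLinearMap.id ℝ (E m)) z :=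
    (hasFDerivAt_id z).sub_const x
  have h1 := ((hasStrictFDerivAt_norm_sq (z - x)).hasFDerivAt.comp z h0).const_mul (-α)
  have h2 := h1.exp
  refine h2.congr_fderiv ?_
  ext v
  simp [bar]
  ring

lemma bar_lap {m : ℕ} (α : ℝ) (x z : E m) :
    lap (bar α x) z = (4 * α^2 * ‖z - x‖^2 - 2 * α * m) * bar α x z := by
  unfold lap
  have h : ∀ i : Fin m, fderiv ℝ (fun y => fderiv ℝ (bar α x) y (EuclideanSpace.single i 1)) z
      (EuclideanSpace.single i 1) = (4 * α^2 * ((z - x) i)^2 - 2 * α) * bar α x z := by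
    intro i
    have e1 : (fun y => fderiv ℝ (bar α x) y (EuclideanSpace.single i 1)) =
        fun y => (-2 * α) * (bar α x y * (EuclideanSpace.proj i : E m →L[ℝ] ℝ) (y - x)) := by
      ext y
      rw [(bar_fderiv α x y).fderiv]
      simp [EuclideanSpace.inner_single_right]
      ring
    rw [e1]
    have h0 : HasFDerivAt (fun z : E m => (EuclideanSpace.proj i : E m →L[ℝ] ℝ) (z - x))
        (EuclideanSpace.proj i : E m →L[ℝ] ℝ) z :=
      (EuclideanSpace.proj i : E m →L[ℝ] ℝ).hasFDerivAt.comp z ((hasFDerivAt_id z).sub_const x)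
    have h1 := ((bar_fderiv α x z).fun_mul h0).const_mul (-2 * α)
    rw [h1.fderiv]
    simp [EuclideanSpace.inner_single_right]
    ring
  simp only [h]
  rw [← Finset.sum_mul, Finset.sum_sub_distrib, ← Finset.mul_sum, EuclideanSpace.real_norm_sq_eq]
  simp
  ring_nf
  simp

lemma lap_sub_smul {m : ℕ} {f h : E m → ℝ} {z : E m} (hf : ContDiffAt ℝ 2 f z)
    (hh : ContDiffAt ℝ 2 h z) (c : ℝ) :
    lap (fun y => f y - c * h y) z = lap f z - c * lap h z := by
  unfold lap
  rw [Finset.mul_sum, ← Finset.sum_sub_distrib]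
  refine Finset.sum_congr rfl fun i _ => ?_
  set e : E m := EuclideanSpace.single i 1
  have e1 : (fun y => fderiv ℝ (fun y => f y - c * h y) y e) =ᶠ[𝓝 z]
      fun y => fderiv ℝ f y e - c * fderiv ℝ h y e := by
    filter_upwards [hf.eventually (by simp), hh.eventually (by simp)] with y h1 h2
    have := (h1.differentiableAt (by norm_num)).hasFDerivAt.fun_sub
      ((h2.differentiableAt (by norm_num)).hasFDerivAt.const_mul c)
    rw [this.fderiv]
    simp
  rw [e1.fderiv_eq]
  have d1 : DifferentiableAt ℝ (fun y => fderiv ℝ f y e) z :=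
    ((hf.fderiv_right (m := 1) (by norm_num)).differentiableAt (by norm_num)).clm_apply
        (differentiableAt_const e)
  have d2 : DifferentiableAt ℝ (fun y => fderiv ℝ h y e) z :=
    ((hh.fderiv_right (m := 1) (by norm_num)).differentiableAt (by norm_num)).clm_apply
        (differentiableAt_const e)
  rw [(d1.hasFDerivAt.fun_sub (d2.hasFDerivAt.const_mul c)).fderiv]
  simp

/-- Hopf-type estimate. -/
lemma hopf (m : ℕ) : ∃ C : ℝ, 0 < C ∧ ∀ (f : E m → ℝ) (U : Set (E m)), IsOpen U → HarmOn U f →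
    ∀ (x y : E m) (d : ℝ), 0 < d → closedBall x d ⊆ U → (∀ w ∈ closedBall x d, 0 ≤ f w) →
    dist y x = d → f y = 0 → f x ≤ C * d * ‖gradient f y‖ := by
  obtain ⟨C, hC, hH⟩ := harnack m
  set β : ℝ := 81 * m + 1 with hβ
  have hβ0 : 0 < β := by positivity
  set q : ℝ := Real.exp (-β * (1/81)) - Real.exp (-β) with hq
  have hq0 : 0 < q := by
    have : Real.exp (-β) < Real.exp (-β * (1/81)) := Real.exp_lt_exp.2 (by linarith)
    linarith
  refine ⟨C * q / (2 * β * Real.exp (-β)), by positivity, ?_⟩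
  intro f U hU hf x y d hd hsub hpos hyx hfy
  set α : ℝ := β / d^2 with hα
  have hα0 : 0 < α := by positivity
  have hαd : α * d^2 = β := by rw [hα]; field_simp
  have hfx : 0 ≤ f x := hpos x (mem_closedBall_self hd.le)
  set ε : ℝ := f x / (C * q) with hε
  have hε0 : 0 ≤ ε := by positivity
  have hεq : ε * q = f x / C := by rw [hε]; field_simp
  let w : E m → ℝ := fun z => f z - ε * bar α x z
  set A : Set (E m) := closedBall x d ∩ {z | d/9 ≤ dist z x} with hA
  have hAc : IsCompact A := (isCompact_closedBall x d).inter_right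
    (isClosed_le continuous_const (continuous_id.dist continuous_const))
  have hyA : y ∈ A := ⟨by simp [hyx], by simp only [Set.mem_ofPred_eq, hyx]; linarith⟩
  have hwc : ContinuousOn w A := by
    refine (hf.1.continuousOn.mono (Set.inter_subset_left.trans hsub)).sub ?_
    exact (continuous_const.mul (bar_contDiff α x).continuous).continuousOn
  have hbarv : ∀ z : E m, bar α x z = Real.exp (-α * (dist z x)^2) := by
    intro z; rw [bar, dist_eq_norm]
  have hby : bar α x y = Real.exp (-β) := by rw [hbarv, hyx, neg_mul, hαd]
  -- lower bound on w
  have hmain : ∀ z ∈ A, - ε * Real.exp (-β) ≤ w z := by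
    rcases hε0.eq_or_lt with h0 | hεpos
    · intro z hz
      simp only [w, ← h0]
      simpa using hpos z hz.1
    obtain ⟨z₀, hz₀, hminz⟩ := hAc.exists_isMinOn ⟨y, hyA⟩ hwc
    suffices - ε * Real.exp (-β) ≤ w z₀ from fun z hz => this.trans (hminz hz)
    have hz1 : dist z₀ x ≤ d := hz₀.1
    have hz2 : d / 9 ≤ dist z₀ x := hz₀.2
    rcases hz1.eq_or_lt with h1 | h1
    · have : bar α x z₀ = Real.exp (-β) := by rw [hbarv, h1, neg_mul, hαd]
      have h2 := hpos z₀ hz₀.1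
      simp only [w, this]
      linarith
    rcases hz2.eq_or_lt with h2 | h2
    · have hb : bar α x z₀ = Real.exp (-β * (1/81)) := by
        rw [hbarv, ← h2, ← hαd]; ring_nf
      have h3 := (hH f x d hd (hf.mono (ball_subset_closedBall.trans hsub))
        (fun v hv => hpos v (ball_subset_closedBall hv)) z₀ h2.symm.le).2
      have h4 : f x / C ≤ f z₀ := by rw [div_le_iff₀ hC]; linarith
      simp only [w, hb]
      rw [← hεq, hq] at h4
      linarith
    · exfalso
      have hnhd : A ∈ 𝓝 z₀ := by
        have o : IsOpen (ball x d ∩ {z | d/9 < dist z x}) := isOpen_ball.inter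
          (isOpen_lt continuous_const (continuous_id.dist continuous_const))
        refine mem_of_superset (o.mem_nhds ⟨h1, h2⟩) ?_
        rintro v ⟨hv1, hv2⟩
        exact ⟨ball_subset_closedBall hv1, Set.mem_ofPred_eq ▸ le_of_lt (show d/9 < dist v x from hv2)⟩
      have hzU : z₀ ∈ U := hsub hz₀.1
      have hfc : ContDiffAt ℝ 2 f z₀ := hf.1.contDiffAt (hU.mem_nhds hzU)
      have hbc : ContDiffAt ℝ 2 (bar α x) z₀ := (bar_contDiff α x).contDiffAt
      have hl := lap_nonneg_of_min (w := w) (hfc.sub (contDiffAt_const.mul hbc))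
        (hminz.isLocalMin hnhd)
      rw [lap_sub_smul hfc hbc, hf.2 _ hzU, bar_lap] at hl
      have hp : 0 < bar α x z₀ := Real.exp_pos _
      have hk : 0 < 4 * α^2 * ‖z₀ - x‖^2 - 2 * α * m := by
        rw [← dist_eq_norm]
        have h5 : (d/9)^2 ≤ (dist z₀ x)^2 := by gcongr
        have h6 : α * (d/9)^2 ≤ α * (dist z₀ x)^2 := by gcongr
        have h7 : α * (d/9)^2 = β / 81 := by rw [← hαd]; ring
        have h8 : (0:ℝ) < 4 * (α * (dist z₀ x)^2) - 2 * m := by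
          have : (0:ℝ) ≤ m := Nat.cast_nonneg m
          rw [h7, hβ] at h6
          linarith
        have := mul_pos hα0 h8
        linarith
      have := mul_pos hεpos (mul_pos hk hp)
      linarith
  -- derivative at y along the inward direction
  have hyU : y ∈ U := hsub (by simp [hyx])
  have hfd := ((hf.1.contDiffAt (hU.mem_nhds hyU)).differentiableAt (by norm_num)).hasFDerivAt
  have hwd : HasFDerivAt w (fderiv ℝ f y - ε • ((-2 * α * bar α x y) • innerSL ℝ (y - x))) y :=
    hfd.sub ((bar_fderiv α x y).const_mul ε)
  have hline : HasDerivAt (fun s : ℝ => y + s • (x - y)) (x - y) 0 := by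
    simpa using ((hasDerivAt_id (0:ℝ)).smul_const (x - y)).const_add y
  have hwd' : HasFDerivAt w (fderiv ℝ f y - ε • ((-2 * α * bar α x y) • innerSL ℝ (y - x)))
      (y + (0:ℝ) • (x - y)) := by simpa using hwd
  have hgd := hwd'.comp_hasDerivAt (0:ℝ) hline
  have hnonneg : 0 ≤ (fderiv ℝ f y - ε • ((-2 * α * bar α x y) • innerSL ℝ (y - x))) (x - y) := by
    have ht := hasDerivWithinAt_iff_tendsto_slope.1 (hgd.hasDerivWithinAt (s := Set.Ioi 0))
    have hset : Set.Ioi (0:ℝ) \ {0} = Set.Ioi 0 := by ext; simp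
    rw [hset] at ht
    refine ge_of_tendsto ht ?_
    have hI : Set.Ioo (0:ℝ) (1/2) ∈ 𝓝[Set.Ioi 0] (0:ℝ) := Ioo_mem_nhdsGT (by norm_num)
    filter_upwards [hI] with s hs
    have hs0 := hs.1
    have hs1 := hs.2
    have hdist : dist (y + s • (x - y)) x = (1 - s) * d := by
      rw [dist_eq_norm, ← hyx, dist_eq_norm]
      have : y + s • (x - y) - x = (1 - s) • (y - x) := by
        rw [sub_smul, one_smul, smul_sub, smul_sub]; abel
      rw [this, norm_smul, Real.norm_of_nonneg (by linarith)]
    have hmem : y + s • (x - y) ∈ A := by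
      constructor
      · rw [mem_closedBall, hdist]; nlinarith
      · simp only [Set.mem_ofPred_eq, hdist]; nlinarith
    have h1 := hmain _ hmem
    rw [slope_def_field]
    refine div_nonneg ?_ (by linarith)
    have h2 : w y = -ε * Real.exp (-β) := by simp only [w, hfy, hby]; ring
    simp only [Function.comp_def, zero_smul, add_zero, h2]
    linarith
  have hinner : (innerSL ℝ (y - x)) (x - y) = - d^2 := by
    rw [← neg_sub y x, map_neg, innerSL_apply_apply, real_inner_self_eq_norm_sq, ← dist_eq_norm, hyx]
  have hval : (fderiv ℝ f y - ε • ((-2 * α * bar α x y) • innerSL ℝ (y - x))) (x - y)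
      = fderiv ℝ f y (x - y) - ε * (2 * β * Real.exp (-β)) := by
    rw [sub_apply, smul_apply, smul_apply, hinner, hby, ← hαd]
    simp only [smul_eq_mul]
    ring
  rw [hval] at hnonneg
  have hnorm : fderiv ℝ f y (x - y) ≤ ‖gradient f y‖ * d := by
    have h1 : ‖gradient f y‖ = ‖fderiv ℝ f y‖ := by
      unfold gradient
      exact LinearIsometryEquiv.norm_map _ _
    rw [h1, ← hyx, dist_comm, dist_eq_norm]
    exact (le_abs_self _).trans ((fderiv ℝ f y).le_opNorm _)
  have h9 : ε * (2 * β * Real.exp (-β)) ≤ ‖gradient f y‖ * d := by linarith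
  have hpos2 : 0 < 2 * β * Real.exp (-β) := by positivity
  have h10 : f x = ε * (C * q) := by rw [hε]; field_simp
  rw [h10]
  have : C * q / (2 * β * Real.exp (-β)) * d * ‖gradient f y‖
      = (‖gradient f y‖ * d) / (2 * β * Real.exp (-β)) * (C * q) := by ring
  rw [this]
  gcongr
  rw [le_div_iff₀ hpos2]
  exact h9


lemma norm_gradient' {m : ℕ} (f : E m → ℝ) (y : E m) : ‖gradient f y‖ = ‖fderiv ℝ f y‖ := by
  unfold gradient
  exact LinearIsometryEquiv.norm_map _ _

lemma hsign_pos {m : ℕ} {g : E m → ℝ} {S : Set (E m)} (hS : IsPreconnected S)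
    (hg : ContinuousOn g S) (hne : ∀ w ∈ S, g w ≠ 0) {p : E m} (hp : p ∈ S) (hgp : 0 < g p) :
    ∀ w ∈ S, 0 < g w := by
  intro w hw
  by_contra hc
  push Not at hc
  obtain ⟨v, hv, hv0⟩ := hS.intermediate_value hw hp hg ⟨hc, hgp.le⟩
  exact hne v hv hv0

lemma zero_bound {m : ℕ} {C : ℝ} (hC : 0 < C)
    (hH : ∀ (f : E m → ℝ) (U : Set (E m)), IsOpen U → HarmOn U f →
    ∀ (x y : E m) (d : ℝ), 0 < d → closedBall x d ⊆ U → (∀ w ∈ closedBall x d, 0 ≤ f w) →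
    dist y x = d → f y = 0 → f x ≤ C * d * ‖gradient f y‖)
    {g : E m → ℝ} {U : Set (E m)} (hU : IsOpen U) (hg : HarmOn U g) {x0 : E m} {R Mk : ℝ}
    (hR : 0 < R) (hsub : closedBall x0 (2 * R) ⊆ U)
    (hM : ∀ x ∈ closedBall x0 (2 * R), g x = 0 → ‖gradient g x‖ ≤ Mk)
    {y0 x : E m} (hy0 : y0 ∈ ball x0 R) (hgy : g y0 = 0) (hx : x ∈ ball x0 (R / 9))
    (hgx : 0 < g x) : g x ≤ C * (2 * R) * Mk := by
  rw [mem_ball] at hx hy0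
  have hs1 : closedBall x (dist y0 x) ⊆ closedBall x0 (2 * R) := by
    refine closedBall_subset_closedBall' ?_
    have := dist_triangle_right y0 x x0
    linarith
  have hgc : ContinuousOn g U := hg.1.continuousOn
  have hZ : IsCompact (closedBall x (dist y0 x) ∩ g ⁻¹' {0}) := by
    refine (isCompact_closedBall x _).of_isClosed_subset ?_ Set.inter_subset_left
    exact (hgc.mono (hs1.trans hsub)).preimage_isClosed_of_isClosed isClosed_closedBall
      isClosed_singleton
  obtain ⟨y, hy, hmin⟩ := hZ.exists_isMinOn (f := fun y => dist y x)
    ⟨y0, by simp, hgy⟩ (by fun_prop)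
  have hgy' : g y = 0 := hy.2
  set d := dist y x with hd
  have hdle : d ≤ dist y0 x := hy.1
  have hdpos : 0 < d := by
    refine dist_pos.2 fun h => ?_
    rw [h] at hgy'; linarith
  have hs2 : closedBall x d ⊆ closedBall x (dist y0 x) := closedBall_subset_closedBall hdle
  have hs3 : closedBall x d ⊆ U := hs2.trans (hs1.trans hsub)
  have hne : ∀ w ∈ ball x d, g w ≠ 0 := by
    intro w hw h0
    have : d ≤ dist w x := hmin (a := w) ⟨hs2 (ball_subset_closedBall hw), h0⟩
    rw [mem_ball] at hw
    linarith
  have hnn : ∀ w ∈ closedBall x d, 0 ≤ g w := by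
    intro w hw
    by_cases h0 : g w = 0
    · exact h0.ge
    have hpc : IsPreconnected (insert w (ball x d)) := by
      refine (convex_ball x d).isPreconnected.subset_closure (Set.subset_insert _ _) ?_
      rw [closure_ball x hdpos.ne']
      exact Set.insert_subset hw ball_subset_closedBall
    refine (hsign_pos hpc (hgc.mono ?_) ?_ (Set.mem_insert_of_mem w (mem_ball_self hdpos)) hgx w
      (Set.mem_insert _ _)).le
    · exact (Set.insert_subset hw ball_subset_closedBall).trans hs3
    · intro v hv
      rcases hv with rfl | hv
      · exact h0
      · exact hne v hv
  have h1 := hH g U hU hg x y d hdpos hs3 hnn rfl hgy'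
  have h2 := hM y (hs1 hy.1) hgy'
  refine h1.trans ?_
  have hd2 : d ≤ 2 * R := by
    have := dist_triangle_right y0 x x0
    linarith
  gcongr

lemma dichotomy {m : ℕ} {U : Set (E m)} (hU : IsOpen U) {x0 : E m} (hx0 : x0 ∈ U)
    (M : Set (E m) → ℝ) :
    ∃ r > 0, ∃ C > 0, closedBall x0 r ⊆ U ∧ ∀ g : E m → ℝ, HarmOn U g →
      (∀ K, K ⊆ U → IsCompact K → ∀ x ∈ K, g x = 0 → ‖gradient g x‖ ≤ M K) →
      (∀ x ∈ ball x0 r, |g x| ≤ C) ∨ (∀ x ∈ ball x0 r, ∀ y ∈ ball x0 r, 0 < g x ∧ g x ≤ C * g y)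
      ∨ (∀ x ∈ ball x0 r, ∀ y ∈ ball x0 r, 0 < - g x ∧ - g x ≤ C * - g y) := by
  obtain ⟨R', hR', hsub'⟩ := nhds_basis_closedBall.mem_iff.1 (hU.mem_nhds hx0)
  obtain ⟨C1, hC1, hH⟩ := hopf m
  obtain ⟨C2, hC2, hHar⟩ := harnack m
  set R := R' / 2 with hR
  have hR0 : 0 < R := by positivity
  have hsub : closedBall x0 (2 * R) ⊆ U := by
    rw [hR]; convert hsub' using 2; ring
  have hbR : ball x0 R ⊆ U := (ball_subset_closedBall.trans
    (closedBall_subset_closedBall (by linarith))).trans hsub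
  set Mk := M (closedBall x0 (2 * R))
  refine ⟨R / 9, by positivity, max (C1 * (2 * R) * Mk) (C2 * C2),
    lt_max_of_lt_right (by positivity),
    (closedBall_subset_closedBall (by linarith)).trans hsub, ?_⟩
  intro g hg hgM
  have hMg := hgM _ hsub (isCompact_closedBall _ _)
  have hneg := hg.neg
  have hMn : ∀ x ∈ closedBall x0 (2 * R), - g x = 0 → ‖gradient (fun x => - g x) x‖ ≤ Mk := by
    intro x hx h
    rw [norm_gradient', fderiv_fun_neg, norm_neg, ← norm_gradient']
    exact hMg x hx (by linarith)
  have harn : ∀ g : E m → ℝ, HarmOn U g → (∀ x ∈ ball x0 R, 0 < g x) →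
      ∀ x ∈ ball x0 (R/9), ∀ y ∈ ball x0 (R/9), 0 < g x ∧
        g x ≤ max (C1 * (2 * R) * Mk) (C2 * C2) * g y := by
    intro g hg hp x hx y hy
    have hss : ball x0 (R/9) ⊆ ball x0 R := ball_subset_ball (by linarith)
    refine ⟨hp x (hss hx), ?_⟩
    have h1 := (hHar g x0 R hR0 (hg.mono hbR) (fun w hw => (hp w hw).le) x (le_of_lt hx)).1
    have h2 := (hHar g x0 R hR0 (hg.mono hbR) (fun w hw => (hp w hw).le) y (le_of_lt hy)).2
    have h3 := (hp y (hss hy)).le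
    calc g x ≤ C2 * (C2 * g y) := h1.trans (by gcongr)
      _ = (C2 * C2) * g y := by ring
      _ ≤ _ := by gcongr; exact le_max_right _ _
  by_cases hz : ∃ y0 ∈ ball x0 R, g y0 = 0
  · left
    obtain ⟨y0, hy0, hgy0⟩ := hz
    intro x hx
    refine le_trans ?_ (le_max_left _ _)
    rcases lt_trichotomy (g x) 0 with h | h | h
    · have := zero_bound hC1 hH hU hneg hR0 hsub hMn hy0 (by simpa using hgy0) hx (by linarith)
      rwa [abs_of_neg h]
    · rw [h, abs_zero]
      have h1 : 0 ≤ Mk := le_trans (norm_nonneg _)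
        (hMg y0 (ball_subset_closedBall (ball_subset_ball (by linarith) hy0)) hgy0)
      positivity
    · have := zero_bound hC1 hH hU hg hR0 hsub hMg hy0 hgy0 hx h
      rwa [abs_of_pos h]
  · right
    push Not at hz
    have hpc := (convex_ball x0 R).isPreconnected
    have hx0R := mem_ball_self (x := x0) hR0
    rcases lt_or_gt_of_ne (hz x0 hx0R) with h | h
    · right
      refine harn _ hneg (hsign_pos hpc (hneg.1.continuousOn.mono hbR) ?_ hx0R (by linarith))
      exact fun w hw => neg_ne_zero.2 (hz w hw)
    · left
      exact harn _ hg (hsign_pos hpc (hg.1.continuousOn.mono hbR) hz hx0R h)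

open MeasureTheory in
lemma lip_est (m : ℕ) : ∃ L : ℝ, 0 ≤ L ∧ ∀ (f : E m → ℝ) (x z : E m) (R B : ℝ), 0 < R →
    HarmOn (ball x R) f → (∀ w ∈ ball x R, |f w| ≤ B) → dist z x ≤ R / 4 →
    |f z - f x| ≤ L * B / R * dist z x := by
  let φ : E m → ℝ := fun y => psi2 (‖y‖^2)
  have hφs : HasCompactSupport φ := radial_hcs psi2_zero
  have hφd : ContDiff ℝ 1 φ := (psi2_contDiff (n := 1)).comp (contDiff_norm_sq ℝ)
  obtain ⟨Lφ, hL⟩ := ContDiff.lipschitzWith_of_hasCompactSupport hφs hφd (by norm_num)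
  have hc := psi2_int m
  set c := ∫ y : E m, psi2 (‖y‖^2)
  set V := volume.real (closedBall (0 : E m) (3/2)) with hV
  refine ⟨2 * Lφ * V / c, by positivity, ?_⟩
  intro f x z R B hR hf hB hz
  have hB0 : 0 ≤ B := (abs_nonneg _).trans (hB x (mem_ball_self hR))
  set t := R / 2 with ht
  have ht0 : 0 < t := by positivity
  have hfz : HarmOn (ball z (3 * R / 4)) f := hf.mono (ball_subset_ball' (by linarith))
  have e1 := mvp_shift (x := x) hfz psi2_cont psi2_zero ht0 (by linarith)
  have e2 := mvp hf psi2_cont psi2_zero ht0.le (by linarith)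
  set v := t⁻¹ • (x - z) with hv
  have hvn : ‖v‖ = 2 / R * dist z x := by
    rw [hv, norm_smul, norm_inv, Real.norm_of_nonneg ht0.le, ← dist_eq_norm, dist_comm, ht, inv_div]
  have hv2 : ‖v‖ ≤ 1/2 := by
    rw [hvn, div_mul_eq_mul_div, div_le_iff₀ hR]; linarith
  have hz1 : ∀ y : E m, 3/2 < ‖y‖ → psi2 (‖y + v‖^2) = 0 := by
    intro y hy
    refine psi2_zero _ (radial_out ?_)
    have := norm_sub_le (y + v) v
    rw [add_sub_cancel_right] at this
    linarith
  have hz2 : ∀ y : E m, 3/2 < ‖y‖ → psi2 (‖y‖^2) = 0 := by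
    intro y hy
    refine psi2_zero _ (radial_out ?_)
    linarith
  have i1 : Integrable (fun y : E m => f (x + t • y) * psi2 (‖y + v‖^2)) :=
    integrable_aux hf.1.continuousOn (psi2_cont.comp (by fun_prop)) hz1 ht0.le (by linarith)
  have i2 : Integrable (fun y : E m => f (x + t • y) * psi2 (‖y‖^2)) :=
    integrable_aux hf.1.continuousOn (radial_cont psi2_cont) hz2 ht0.le (by linarith)
  have e3 : (f z - f x) * c = ∫ y in closedBall (0 : E m) (3/2),
      (f (x + t • y) * psi2 (‖y + v‖^2) - f (x + t • y) * psi2 (‖y‖^2)) := by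
    rw [sub_mul, ← e1, ← e2, ← integral_sub i1 i2]
    symm
    refine setIntegral_eq_integral_of_forall_compl_eq_zero fun y hy => ?_
    simp only [mem_closedBall, dist_zero_right, not_le] at hy
    rw [hz1 y hy, hz2 y hy]; ring
  have hbd : |(f z - f x) * c| ≤ (B * (Lφ * ‖v‖)) * V := by
    rw [e3, ← Real.norm_eq_abs]
    refine norm_setIntegral_le_of_norm_le_const (μ := volume) (isCompact_closedBall (0 : E m) (3/2)).measure_lt_top ?_
    intro y hy
    rw [mem_closedBall_zero_iff] at hy
    rw [← mul_sub, norm_mul]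
    have h1 : ‖f (x + t • y)‖ ≤ B := by
      refine hB _ ?_
      rw [mem_ball, dist_eq_norm, add_sub_cancel_left, norm_smul, Real.norm_of_nonneg ht0.le]
      nlinarith
    have h2 : ‖psi2 (‖y + v‖^2) - psi2 (‖y‖^2)‖ ≤ Lφ * ‖v‖ := by
      have := hL.norm_sub_le (y + v) y
      rwa [add_sub_cancel_left] at this
    gcongr
  rw [abs_mul, abs_of_pos hc, hvn] at hbd
  rw [← le_div_iff₀ hc] at hbd
  refine hbd.trans (le_of_eq ?_)
  field_simp


open MeasureTheory in
lemma mvp_limit {m : ℕ} {U : Set (E m)} {f : ℕ → E m → ℝ} {g : E m → ℝ}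
    (hf : ∀ n, HarmOn U (f n)) (hg : ContinuousOn g U) (hlim : TendstoLocallyUniformlyOn f g atTop U)
    {ψ : ℝ → ℝ} (hψ : Continuous ψ) (h0 : ∀ s, 1 ≤ s → ψ s = 0)
    {z : E m} {T t : ℝ} (hT : ball z T ⊆ U) (ht : 0 ≤ t) (htT : t < T) :
    ∫ y : E m, g (z + t • y) * ψ (‖y‖^2) = g z * ∫ y : E m, ψ (‖y‖^2) := by
  have hout : ∀ y : E m, 1 < ‖y‖ → ψ (‖y‖^2) = 0 := fun y hy => h0 _ (radial_out (not_le.2 hy))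
  have hzU : z ∈ U := hT (mem_ball_self (by linarith))
  have hmem : ∀ y : E m, ‖y‖ ≤ 1 → z + t • y ∈ closedBall z t := by
    intro y hy
    rw [mem_closedBall, dist_eq_norm, add_sub_cancel_left, norm_smul, Real.norm_of_nonneg ht]
    nlinarith
  have hcU : closedBall z t ⊆ U := (closedBall_subset_ball htT).trans hT
  have hunif : TendstoUniformlyOn f g atTop (closedBall z t) :=
    (tendstoLocallyUniformlyOn_iff_tendstoUniformlyOn_of_compact (isCompact_closedBall z t)).1
      (hlim.mono hcU)
  have hpt : ∀ w ∈ U, Tendsto (fun n => f n w) atTop (𝓝 (g w)) := fun w hw => hlim.tendsto_at hw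
  have l1 : Tendsto (fun n => ∫ y : E m, f n (z + t • y) * ψ (‖y‖^2)) atTop
      (𝓝 (∫ y : E m, g (z + t • y) * ψ (‖y‖^2))) := by
    refine tendsto_integral_filter_of_dominated_convergence
      (fun y : E m => (|g (z + t • y)| + 1) * |ψ (‖y‖^2)|) ?_ ?_ ?_ ?_
    · refine Eventually.of_forall fun n => Integrable.aestronglyMeasurable ?_
      exact integrable_aux ((hf n).1.continuousOn.mono hT) (radial_cont hψ) hout ht (by linarith)
    · filter_upwards [Metric.tendstoUniformlyOn_iff.1 hunif 1 one_pos] with n hn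
      refine Eventually.of_forall fun y => ?_
      by_cases hy : ‖y‖ ≤ 1
      · rw [norm_mul]
        have := hn _ (hmem y hy)
        rw [Real.norm_eq_abs, Real.norm_eq_abs]
        gcongr
        rw [dist_comm, Real.dist_eq] at this
        have h2 := abs_sub_abs_le_abs_sub (f n (z + t • y)) (g (z + t • y))
        linarith
      · rw [hout y (not_le.1 hy)]; simp
    · exact integrable_aux (r := 1) (f := fun w => |g w| + 1)
        ((hg.mono hT).abs.add continuousOn_const) (radial_cont hψ).abs
        (fun y hy => by simp [hout y hy]) ht (by linarith)
    · refine Eventually.of_forall fun y => ?_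
      by_cases hy : ‖y‖ ≤ 1
      · exact (hpt _ (hcU (hmem y hy))).mul_const _
      · simp [hout y (not_le.1 hy)]
  have l2 : Tendsto (fun n => ∫ y : E m, f n (z + t • y) * ψ (‖y‖^2)) atTop
      (𝓝 (g z * ∫ y : E m, ψ (‖y‖^2))) := by
    have : ∀ n, ∫ y : E m, f n (z + t • y) * ψ (‖y‖^2) = f n z * ∫ y : E m, ψ (‖y‖^2) :=
      fun n => mvp ((hf n).mono hT) hψ h0 ht htT
    simp only [this]
    exact (hpt z hzU).mul_const _
  exact tendsto_nhds_unique l1 l2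

lemma Psi_nonpos {ψ : ℝ → ℝ} (h0 : ∀ s, 1 ≤ s → ψ s = 0) (hn : ∀ s, 0 ≤ ψ s) (s : ℝ) :
    Psi ψ s ≤ 0 := by
  rcases le_total 1 s with h | h
  · exact (Psi_zero h0 h).le
  · unfold Psi
    rw [intervalIntegral.integral_symm]
    have := intervalIntegral.integral_nonneg h (fun u _ => hn u) (μ := MeasureTheory.volume)
    linarith

lemma Psi2_ne : Psi psi2 0 ≠ 0 := by
  have : 0 < ∫ u in (0:ℝ)..1, psi2 u := by
    refine intervalIntegral.intervalIntegral_pos_of_pos_on (psi2_cont.intervalIntegrable _ _) ?_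
      one_pos
    intro u hu
    exact Real.smoothTransition.pos_of_pos (by linarith [hu.2])
  unfold Psi
  rw [intervalIntegral.integral_symm]
  linarith

open MeasureTheory in
lemma harm_of_mvp_c2 {m : ℕ} {g : E m → ℝ} {x0 : E m} {R : ℝ} (hR : 0 < R)
    (hg : ContDiffOn ℝ 2 g (ball x0 R))
    (hm : ∀ t, 0 ≤ t → t < R → ∫ y : E m, g (x0 + t • y) * psi2 (‖y‖^2)
      = g x0 * ∫ y : E m, psi2 (‖y‖^2)) : lap g x0 = 0 := by
  set r := R / 2 with hr
  have hr0 : 0 < r := by positivity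
  obtain ⟨F, hF, hFs, hFg⟩ := exists_ext hr0 (by linarith : r < R) hg
  have hlap : lap g x0 = lap F x0 := by
    refine lap_congr ?_
    filter_upwards [ball_mem_nhds x0 hr0] with y hy using (hFg y hy).symm
  rw [hlap]
  by_contra hne
  have hzint : ∀ t, 0 < t → t < r → ∫ y : E m, lap F (x0 + t • y) * Psi psi2 (‖y‖^2) = 0 := by
    intro t ht htr
    have h1 := mean_deriv hF hFs psi2_cont psi2_zero x0 t
    have h2 : (fun t : ℝ => ∫ y : E m, F (x0 + t • y) * psi2 (‖y‖^2)) =ᶠ[𝓝 t]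
        fun _ => g x0 * ∫ y : E m, psi2 (‖y‖^2) := by
      filter_upwards [Ioo_mem_nhds ht htr] with s hs
      rw [← hm s hs.1.le (by linarith [hs.2])]
      congr 1
      ext y
      by_cases hy : ‖y‖ ≤ 1
      · rw [hFg _ (mem_ball_aux hs.1.le hs.2 hy)]
      · rw [psi2_zero _ (radial_out hy), mul_zero, mul_zero]
    have h3 := h1.unique ((hasDerivAt_const t _).congr_of_eventuallyEq h2)
    have := neg_eq_zero.1 h3
    exact (mul_eq_zero.1 this).resolve_left ht.ne'
  have hcl := lap_cont hF
  have hpos : 0 < lap F x0 * lap F x0 := mul_self_pos.2 hne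
  have hev : ∀ᶠ y in 𝓝 x0, 0 < lap F x0 * lap F y :=
    (continuous_const.mul hcl).continuousAt.eventually (lt_mem_nhds hpos)
  obtain ⟨δ, hδ, hball⟩ := Metric.eventually_nhds_iff_ball.1 hev
  set t := min δ r / 2 with ht
  have hmin : 0 < min δ r := lt_min hδ hr0
  have ht0 : 0 < t := by positivity
  have htd : t < δ := by have := min_le_left δ r; linarith
  have htr : t < r := by have := min_le_right δ r; linarith
  have hP : ∀ s, 1 ≤ s → Psi psi2 s = 0 := fun s hs => Psi_zero psi2_zero hs
  have h5 : 0 < ∫ y : E m, (lap F x0 * lap F (x0 + t • y)) * (- Psi psi2 (‖y‖^2)) := by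
    refine Continuous.integral_pos_of_hasCompactSupport_nonneg_nonzero (x := 0) ?_ ?_ ?_ ?_
    · exact (continuous_const.mul (hcl.comp (by fun_prop))).mul
        (radial_cont (Psi_continuous psi2_cont)).neg
    · exact HasCompactSupport.mul_left (radial_hcs (m := m) hP).neg
    · intro y
      by_cases hy : ‖y‖ ≤ 1
      · refine mul_nonneg (hball _ (mem_ball_aux ht0.le htd hy)).le ?_
        exact neg_nonneg.2 (Psi_nonpos psi2_zero psi2_nonneg _)
      · simp [hP _ (radial_out hy)]
    · simpa [Psi2_ne] using hne
  have h6 : ∫ y : E m, (lap F x0 * lap F (x0 + t • y)) * (- Psi psi2 (‖y‖^2)) =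
      - lap F x0 * ∫ y : E m, lap F (x0 + t • y) * Psi psi2 (‖y‖^2) := by
    rw [← integral_const_mul]
    congr 1
    ext y
    ring
  rw [h6, hzint t ht0 htr, mul_zero] at h5
  exact lt_irrefl _ h5

open MeasureTheory in
lemma c2_of_mvp {m : ℕ} {g : E m → ℝ} {x0 : E m} {R : ℝ} (hR : 0 < R)
    (hg : ContinuousOn g (closedBall x0 (2 * R)))
    (hm : ∀ z ∈ ball x0 R, ∫ y : E m, g (z + R • y) * psi2 (‖y‖^2)
      = g z * ∫ y : E m, psi2 (‖y‖^2)) : ContDiffOn ℝ 2 g (ball x0 R) := by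
  have hc := psi2_int m
  set c := ∫ y : E m, psi2 (‖y‖^2)
  let φ : E m → ℝ := fun y => psi2 (‖y‖^2)
  have hφs : HasCompactSupport φ := radial_hcs psi2_zero
  have hφd : ContDiff ℝ 2 φ := (psi2_contDiff (n := 2)).comp (contDiff_norm_sq ℝ)
  let g' : E m → ℝ := (closedBall x0 (2 * R)).indicator g
  have hgi : Integrable g' :=
    (hg.integrableOn_compact (isCompact_closedBall _ _)).integrable_indicator
      isClosed_closedBall.measurableSet
  have hGi : Integrable (fun w : E m => g' (R • w)) := hgi.comp_smul hR.ne'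
  have hconv := hφs.contDiff_convolution_left (n := 2) (ContinuousLinearMap.mul ℝ ℝ) hφd
    (hGi.locallyIntegrable (μ := volume))
  have hcomp : ContDiff ℝ 2 (fun z : E m => c⁻¹ *
      (MeasureTheory.convolution φ (fun w : E m => g' (R • w)) (ContinuousLinearMap.mul ℝ ℝ) volume)
        (R⁻¹ • z)) :=
    contDiff_const.mul (hconv.comp (contDiff_const_smul _))
  refine hcomp.contDiffOn.congr fun z hz => ?_
  rw [eq_inv_mul_iff_mul_eq₀ hc.ne', mul_comm, ← hm z hz, convolution_def,
    ← integral_neg_eq_self]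
  congr 1
  ext y
  simp only [ContinuousLinearMap.mul_apply', φ, norm_neg]
  rw [mul_comm, smul_sub, smul_inv_smul₀ hR.ne', smul_neg, ← sub_eq_add_neg]
  by_cases hy : ‖y‖ ≤ 1
  · congr 1
    refine (Set.indicator_of_mem ?_ g).symm
    rw [mem_ball, dist_eq_norm] at hz
    rw [mem_closedBall, dist_eq_norm]
    have : z - R • y - x0 = (z - x0) - R • y := by abel
    rw [this]
    refine (norm_sub_le _ _).trans ?_
    rw [norm_smul, Real.norm_of_nonneg hR.le]
    nlinarith
  · rw [psi2_zero _ (radial_out hy), zero_mul, zero_mul]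

lemma harm_limit {m : ℕ} {U : Set (E m)} (hU : IsOpen U) {f : ℕ → E m → ℝ} {g : E m → ℝ}
    (hf : ∀ n, HarmOn U (f n)) (hlim : TendstoLocallyUniformlyOn f g atTop U) : HarmOn U g := by
  have hg : ContinuousOn g U :=
    hlim.continuousOn (Eventually.of_forall fun n => (hf n).1.continuousOn).frequently
  have hloc : ∀ x0 ∈ U, ∃ R > 0, ContDiffOn ℝ 2 g (ball x0 R) ∧ ball x0 R ⊆ U := by
    intro x0 hx0
    obtain ⟨R', hR', hsub'⟩ := nhds_basis_closedBall.mem_iff.1 (hU.mem_nhds hx0)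
    refine ⟨R' / 3, by positivity, ?_, ?_⟩
    · refine c2_of_mvp (by positivity)
        (hg.mono ((closedBall_subset_closedBall (by linarith)).trans hsub')) ?_
      intro z hz
      refine mvp_limit hf hg hlim psi2_cont psi2_zero (T := 2 * (R' / 3)) ?_ (by positivity)
        (by linarith)
      refine ((ball_subset_ball' ?_).trans ball_subset_closedBall).trans hsub'
      rw [mem_ball] at hz
      linarith
    · exact (ball_subset_ball (by linarith)).trans (ball_subset_closedBall.trans hsub')
  refine ⟨?_, ?_⟩
  · intro x0 hx0
    obtain ⟨R, hR, h, _⟩ := hloc x0 hx0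
    exact (h.contDiffAt (ball_mem_nhds x0 hR)).contDiffWithinAt
  · intro x0 hx0
    obtain ⟨R, hR, h, hb⟩ := hloc x0 hx0
    exact harm_of_mvp_c2 hR h fun t ht htR =>
      mvp_limit hf hg hlim psi2_cont psi2_zero hb ht htR


/-- the gradient condition at level zero -/
def Cond {m : ℕ} (U : Set (E m)) (M : Set (E m) → ℝ) (g : E m → ℝ) : Prop :=
  HarmOn U g ∧ ∀ K, K ⊆ U → IsCompact K → ∀ x ∈ K, g x = 0 → ‖gradient g x‖ ≤ M K

lemma Cond.neg {m : ℕ} {U : Set (E m)} {M : Set (E m) → ℝ} {g : E m → ℝ} (h : Cond U M g) :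
    Cond U M (fun x => - g x) := by
  refine ⟨h.1.neg, fun K hK hKc x hx h0 => ?_⟩
  rw [norm_gradient', fderiv_fun_neg, norm_neg, ← norm_gradient']
  exact h.2 K hK hKc x hx (by linarith)

lemma spread {m : ℕ} {U : Set (E m)} (hU : IsOpen U) (hc : IsPreconnected U) (P : E m → Prop)
    (h : ∀ x0 ∈ U, ∃ r > 0, ∀ x ∈ ball x0 r, ∀ y ∈ ball x0 r, P x → P y)
    {p x : E m} (hp : p ∈ U) (hx : x ∈ U) (hP : P p) : P x := by
  refine hc.induction₂' (fun x y => P x → P y) ?_ (fun _ _ _ _ _ _ h1 h2 h => h2 (h1 h)) hp hx hP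
  intro x0 hx0
  obtain ⟨r, hr, h⟩ := h x0 hx0
  filter_upwards [mem_nhdsWithin_of_mem_nhds (ball_mem_nhds x0 hr)] with y hy
  exact ⟨h x0 (mem_ball_self hr) y hy, h y hy x0 (mem_ball_self hr)⟩

lemma blowup_loc {m : ℕ} {U : Set (E m)} (hU : IsOpen U) {M : Set (E m) → ℝ}
    {g : ℕ → E m → ℝ} (hg : ∀ n, Cond U M (g n)) {x0 : E m} (hx0 : x0 ∈ U) :
    ∃ r > 0, ∀ x ∈ ball x0 r, Tendsto (fun n => g n x) atTop atTop →
      ∀ B : ℝ, ∀ᶠ n in atTop, ∀ y ∈ ball x0 r, B ≤ g n y := by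
  obtain ⟨r, hr, C, hC, -, hd⟩ := dichotomy hU hx0 M
  refine ⟨r, hr, fun x hx ht B => ?_⟩
  filter_upwards [ht.eventually_gt_atTop C, ht.eventually_ge_atTop (C * B)] with n h1 h2 y hy
  rcases hd (g n) (hg n).1 (hg n).2 with h | h | h
  · have := (abs_le.1 (h x hx)).2
    linarith
  · have := (h x hx y hy).2
    exact le_of_mul_le_mul_left (h2.trans this) hC
  · have := (h x hx y hy).1
    linarith

lemma blowup {m : ℕ} {U : Set (E m)} (hU : IsOpen U) (hc : IsPreconnected U) {M : Set (E m) → ℝ}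
    {g : ℕ → E m → ℝ} (hg : ∀ n, Cond U M (g n)) {p : E m} (hp : p ∈ U)
    (ht : Tendsto (fun n => g n p) atTop atTop) {K : Set (E m)} (hK : K ⊆ U) (hKc : IsCompact K)
    (B : ℝ) : ∀ᶠ n in atTop, ∀ y ∈ K, B ≤ g n y := by
  have hall : ∀ x ∈ U, Tendsto (fun n => g n x) atTop atTop := by
    intro x hx
    refine spread hU hc (fun x => Tendsto (fun n => g n x) atTop atTop) ?_ hp hx ht
    intro x0 hx0
    obtain ⟨r, hr, h⟩ := blowup_loc hU hg hx0
    refine ⟨r, hr, fun x hx y hy hxt => tendsto_atTop.2 fun B => ?_⟩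
    filter_upwards [h x hx hxt B] with n hn using hn y hy
  refine hKc.induction_on (p := fun S => ∀ᶠ n in atTop, ∀ y ∈ S, B ≤ g n y) (by simp) ?_ ?_ ?_
  · intro s t hst h
    filter_upwards [h] with n hn y hy using hn y (hst hy)
  · intro s t h1 h2
    filter_upwards [h1, h2] with n hn1 hn2 y hy
    exact hy.elim (hn1 y) (hn2 y)
  · intro x hx
    obtain ⟨r, hr, h⟩ := blowup_loc hU hg (hK hx)
    exact ⟨ball x r, mem_nhdsWithin_of_mem_nhds (ball_mem_nhds x hr),
      h x (mem_ball_self hr) (hall x (hK hx)) B⟩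

lemma bdd_loc {m : ℕ} {U : Set (E m)} (hU : IsOpen U) {M : Set (E m) → ℝ}
    {g : ℕ → E m → ℝ} (hg : ∀ n, Cond U M (g n)) {x0 : E m} (hx0 : x0 ∈ U) :
    ∃ r > 0, ball x0 r ⊆ U ∧ ∀ x ∈ ball x0 r, (∃ B, ∀ n, |g n x| ≤ B) →
      ∃ B, ∀ n, ∀ y ∈ ball x0 r, |g n y| ≤ B := by
  obtain ⟨r, hr, C, hC, hsub, hd⟩ := dichotomy hU hx0 M
  refine ⟨r, hr, ball_subset_closedBall.trans hsub, ?_⟩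
  rintro x hx ⟨B, hB⟩
  refine ⟨max C (C * B), fun n y hy => ?_⟩
  have hb := abs_le.1 (hB n)
  rcases hd (g n) (hg n).1 (hg n).2 with h | h | h
  · exact (h y hy).trans (le_max_left _ _)
  · obtain ⟨h1, h2⟩ := h y hy x hx
    rw [abs_of_pos h1]
    refine (h2.trans ?_).trans (le_max_right _ _)
    gcongr; exact hb.2
  · obtain ⟨h1, h2⟩ := h y hy x hx
    rw [abs_of_neg (by linarith)]
    refine (h2.trans ?_).trans (le_max_right _ _)
    gcongr; linarith

lemma compact_seq {m : ℕ} {U : Set (E m)} (hU : IsOpen U) {g : ℕ → E m → ℝ}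
    (hb : ∀ x ∈ U, ∃ B, ∀ n, |g n x| ≤ B)
    (hl : ∀ x0 ∈ U, ∃ r > 0, ∃ L ≥ (0:ℝ), ball x0 r ⊆ U ∧ ∀ n, ∀ x ∈ ball x0 r,
      |g n x - g n x0| ≤ L * dist x x0) :
    ∃ φ : ℕ → ℕ, StrictMono φ ∧ ∃ G : E m → ℝ,
      TendstoLocallyUniformlyOn (fun k => g (φ k)) G atTop U := by
  classical
  let q := TopologicalSpace.denseSeq (E m)
  have hq : DenseRange q := TopologicalSpace.denseRange_denseSeq (E m)
  let F : ℕ → ℕ → ℝ := fun n i => if q i ∈ U then g n (q i) else 0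
  have hFb : ∀ i, ∃ B, ∀ n, F n i ∈ Set.Icc (-B) B := by
    intro i
    by_cases hi : q i ∈ U
    · obtain ⟨B, hB⟩ := hb _ hi
      exact ⟨B, fun n => by simp only [F, if_pos hi]; exact abs_le.1 (hB n)⟩
    · exact ⟨0, fun n => by simp [F, if_neg hi]⟩
  choose B hB using hFb
  obtain ⟨l, -, φ, hφ, hlim⟩ := (isCompact_univ_pi (fun i => isCompact_Icc (a := -B i) (b := B i))).tendsto_subseq
    (x := F) (fun n i _ => hB i n)
  rw [tendsto_pi_nhds] at hlim
  have hdense : ∀ i, q i ∈ U → Tendsto (fun k => g (φ k) (q i)) atTop (𝓝 (l i)) := by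
    intro i hi
    have := hlim i
    simpa only [Function.comp_def, F, if_pos hi] using this
  have hpt : ∀ x ∈ U, ∃ y, Tendsto (fun k => g (φ k) x) atTop (𝓝 y) := by
    intro x hx
    refine cauchySeq_tendsto_of_complete ?_
    obtain ⟨r, hr, L, hL, hsub, hlip⟩ := hl x hx
    rw [Metric.cauchySeq_iff]
    intro ε hε
    have hδ : 0 < min r (ε / (4 * (L + 1))) := by positivity
    obtain ⟨i, hi⟩ := hq.exists_dist_lt x hδ
    rw [dist_comm] at hi
    have hi1 : q i ∈ ball x r := hi.trans_le (min_le_left _ _)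
    have hi2 : L * dist (q i) x ≤ ε / 4 := by
      have h1 : dist (q i) x ≤ ε / (4 * (L + 1)) := (hi.trans_le (min_le_right _ _)).le
      rw [le_div_iff₀ (by positivity)] at h1
      have := dist_nonneg (x := q i) (y := x)
      nlinarith
    obtain ⟨N, hN⟩ := Metric.cauchySeq_iff.1 (hdense i (hsub hi1)).cauchySeq (ε / 2) (by positivity)
    refine ⟨N, fun a ha b hb => ?_⟩
    have h1 := hN a ha b hb
    have h2 := abs_le.1 ((hlip (φ a) _ hi1).trans hi2)
    have h3 := abs_le.1 ((hlip (φ b) _ hi1).trans hi2)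
    rw [Real.dist_eq, abs_lt] at h1 ⊢
    constructor <;> linarith [h1.1, h1.2, h2.1, h2.2, h3.1, h3.2]
  choose! G hG using hpt
  refine ⟨φ, hφ, G, ?_⟩
  rw [Metric.tendstoLocallyUniformlyOn_iff]
  intro ε hε x hx
  obtain ⟨r, hr, L, hL, hsub, hlip⟩ := hl x hx
  have hδ : 0 < min r (ε / (4 * (L + 1))) := by positivity
  refine ⟨ball x (min r (ε / (4 * (L + 1)))), mem_nhdsWithin_of_mem_nhds (ball_mem_nhds x hδ), ?_⟩
  have hG' : ∀ y ∈ ball x r, |G y - G x| ≤ L * dist y x := by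
    intro y hy
    exact le_of_tendsto ((hG y (hsub hy)).sub (hG x hx)).abs
      (Eventually.of_forall fun n => hlip (φ n) y hy)
  filter_upwards [Metric.tendsto_nhds.1 (hG x hx) (ε/4) (by positivity)] with n hn y hy
  have hi1 : y ∈ ball x r := (mem_ball.1 hy).trans_le (min_le_left _ _)
  have hi2 : L * dist y x ≤ ε / 4 := by
    have h1 : dist y x ≤ ε / (4 * (L + 1)) := ((mem_ball.1 hy).trans_le (min_le_right _ _)).le
    rw [le_div_iff₀ (by positivity)] at h1
    have := dist_nonneg (x := y) (y := x)
    nlinarith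
  have h2 := abs_le.1 ((hlip (φ n) _ hi1).trans hi2)
  have h3 := abs_le.1 ((hG' _ hi1).trans hi2)
  rw [Real.dist_eq, abs_lt] at hn ⊢
  constructor <;> linarith [hn.1, hn.2, h2.1, h2.2, h3.1, h3.2]

lemma bounded_case {m : ℕ} {U : Set (E m)} (hU : IsOpen U) (hc : IsPreconnected U)
    {M : Set (E m) → ℝ} {g : ℕ → E m → ℝ} (hg : ∀ n, Cond U M (g n)) {p : E m} (hp : p ∈ U)
    (hb : ∃ B, ∀ n, |g n p| ≤ B) :
    ∃ φ : ℕ → ℕ, StrictMono φ ∧ ∃ G : E m → ℝ, HarmOn U G ∧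
      TendstoLocallyUniformlyOn (fun k => g (φ k)) G atTop U := by
  have hall : ∀ x ∈ U, ∃ B, ∀ n, |g n x| ≤ B := by
    intro x hx
    refine spread hU hc (fun x => ∃ B, ∀ n, |g n x| ≤ B) ?_ hp hx hb
    intro x0 hx0
    obtain ⟨r, hr, -, h⟩ := bdd_loc hU hg hx0
    refine ⟨r, hr, fun x hx y hy hxt => ?_⟩
    obtain ⟨B, hB⟩ := h x hx hxt
    exact ⟨B, fun n => hB n y hy⟩
  obtain ⟨L, hL, hlip⟩ := lip_est m
  obtain ⟨φ, hφ, G, hG⟩ := compact_seq hU hall (by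
    intro x0 hx0
    obtain ⟨r, hr, hsub, h⟩ := bdd_loc hU hg hx0
    obtain ⟨B, hB⟩ := h x0 (mem_ball_self hr) (hall x0 hx0)
    have hB0 : 0 ≤ B := (abs_nonneg _).trans (hB 0 x0 (mem_ball_self hr))
    refine ⟨r / 4, by positivity, L * B / r, by positivity,
      (ball_subset_ball (by linarith)).trans hsub, fun n x hx => ?_⟩
    exact hlip (g n) x0 x r B hr ((hg n).1.mono hsub) (hB n) (le_of_lt hx))
  exact ⟨φ, hφ, G, harm_limit hU (fun k => (hg (φ k)).1) hG, hG⟩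

lemma SF_coe (x : ℝ) : SF (x : EReal) = Real.arctan (Real.sinh x) := by
  simp [SF]

lemma SF_top : SF ⊤ = Real.pi / 2 := by simp [SF]
lemma SF_bot : SF ⊥ = -(Real.pi / 2) := by simp [SF]

lemma S_lip (x y : ℝ) :
    |Real.arctan (Real.sinh x) - Real.arctan (Real.sinh y)| ≤ |x - y| := by
  have hd : ∀ z : ℝ, HasDerivAt (fun z => Real.arctan (Real.sinh z))
      (1 / (1 + Real.sinh z ^ 2) * Real.cosh z) z := fun z => (Real.hasDerivAt_sinh z).arctan
  have hb : ∀ z : ℝ, ‖1 / (1 + Real.sinh z ^ 2) * Real.cosh z‖ ≤ 1 := by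
    intro z
    have h1 : 1 + Real.sinh z ^ 2 = Real.cosh z ^ 2 := by rw [Real.cosh_sq]; ring
    have h2 := Real.one_le_cosh z
    rw [h1, Real.norm_of_nonneg (by positivity), div_mul_eq_mul_div, div_le_one (by positivity)]
    nlinarith
  have := Convex.norm_image_sub_le_of_norm_hasDerivWithin_le (s := Set.univ)
    (fun z _ => (hd z).hasDerivWithinAt) (fun z _ => hb z) convex_univ (Set.mem_univ y) (Set.mem_univ x)
  simpa using this

lemma S_mono {x y : ℝ} (h : x ≤ y) :
    Real.arctan (Real.sinh x) ≤ Real.arctan (Real.sinh y) :=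
  Real.arctan_strictMono.monotone (Real.sinh_le_sinh.2 h)

lemma S_top {ε : ℝ} (hε : 0 < ε) : ∃ B : ℝ, ∀ x, B ≤ x →
    |Real.arctan (Real.sinh x) - Real.pi / 2| < ε := by
  have ht : Tendsto (fun x => Real.arctan (Real.sinh x)) atTop (𝓝 (Real.pi / 2)) := by
    have h1 : Tendsto Real.sinh atTop atTop :=
      tendsto_atTop_mono' atTop
        ((eventually_ge_atTop (0:ℝ)).mono fun x hx => Real.self_le_sinh_iff.2 hx) tendsto_id
    exact (Real.tendsto_arctan_atTop.mono_right nhdsWithin_le_nhds).comp h1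
  obtain ⟨B, hB⟩ := (Metric.tendsto_atTop.1 ht) ε hε
  exact ⟨B, fun x hx => by simpa [Real.dist_eq] using hB x hx⟩

/-- **Normality criterion 1.** Fix `a ∈ ℝ` and, for each compact `K ⊆ U`, a constant
`M_K > 0`. The family of harmonic functions `f` on `U` such that `|∇f| ≤ M_K` on
`f⁻¹(a) ∩ K` for every compact `K ⊆ U` is normal. -/
theorem stmt8 {m : ℕ} (U : Set (E m)) (hUo : IsOpen U) (hUc : IsConnected U)
    (a : ℝ) (M : Set (E m) → ℝ) (hM : ∀ K, K ⊆ U → IsCompact K → 0 < M K) :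
    NormalFam U {f | HarmOn U f ∧
      ∀ K, K ⊆ U → IsCompact K → ∀ x ∈ K, f x = a → ‖gradient f x‖ ≤ M K} := by
  intro f hf
  obtain ⟨p, hp⟩ := hUc.nonempty
  have hpc := hUc.isPreconnected
  let g : ℕ → E m → ℝ := fun n x => f n x - a
  have hg : ∀ n, Cond U M (g n) := by
    intro n
    refine ⟨(hf n).1.sub_const a, fun K hK hKc x hx h0 => ?_⟩
    rw [norm_gradient', fderiv_sub_const, ← norm_gradient']
    exact (hf n).2 K hK hKc x hx (by simp only [g] at h0; linarith)
  obtain ⟨l, -, φ, hφ, hlim⟩ := (isCompact_univ (X := EReal)).tendsto_subseq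
    (x := fun n => ((g n p : ℝ) : EReal)) (fun _ => Set.mem_univ _)
  induction l with
  | top =>
    refine ⟨φ, hφ, Or.inr (Or.inl ?_)⟩
    have ht : Tendsto (fun k => g (φ k) p) atTop atTop := EReal.tendsto_coe_nhds_top_iff.1 hlim
    intro K hK hKc ε hε
    obtain ⟨B, hB⟩ := S_top hε
    obtain ⟨N, hN⟩ := eventually_atTop.1
      (blowup hUo hpc (fun k => hg (φ k)) hp ht hK hKc (B - a))
    refine ⟨N, fun n hn x hx => ?_⟩
    rw [SF_coe, SF_top]
    have h := hN n hn x hx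
    simp only [g] at h
    exact hB _ (by linarith)
  | bot =>
    refine ⟨φ, hφ, Or.inr (Or.inr ?_)⟩
    have ht : Tendsto (fun k => - g (φ k) p) atTop atTop :=
      tendsto_neg_atBot_atTop.comp (EReal.tendsto_coe_nhds_bot_iff.1 hlim)
    intro K hK hKc ε hε
    obtain ⟨B, hB⟩ := S_top hε
    obtain ⟨N, hN⟩ := eventually_atTop.1
      (blowup hUo hpc (fun k => (hg (φ k)).neg) hp ht hK hKc (B + a))
    refine ⟨N, fun n hn x hx => ?_⟩
    rw [SF_coe, SF_bot]
    have h := hN n hn x hx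
    simp only [g] at h
    have h2 := hB (- f (φ n) x) (by linarith)
    rw [Real.sinh_neg, Real.arctan_neg] at h2
    rw [← abs_neg]
    convert h2 using 2
    ring
  | coe l =>
    have ht : Tendsto (fun k => g (φ k) p) atTop (𝓝 l) := EReal.tendsto_coe.1 hlim
    have hbd : ∃ B, ∀ k, |g (φ k) p| ≤ B := by
      obtain ⟨B, hB⟩ := ht.abs.bddAbove_range
      exact ⟨B, fun k => hB ⟨k, rfl⟩⟩
    obtain ⟨θ, hθ, G, hGh, hG⟩ := bounded_case hUo hpc (fun k => hg (φ k)) hp hbd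
    refine ⟨φ ∘ θ, hφ.comp hθ, Or.inl ⟨fun x => G x - (-a), hGh.sub_const (-a), ?_⟩⟩
    intro K hK hKc ε hε
    have hu := (tendstoLocallyUniformlyOn_iff_tendstoUniformlyOn_of_compact hKc).1 (hG.mono hK)
    obtain ⟨N, hN⟩ := eventually_atTop.1 (Metric.tendstoUniformlyOn_iff.1 hu ε hε)
    refine ⟨N, fun n hn x hx => ?_⟩
    rw [SF_coe, SF_coe]
    refine (S_lip _ _).trans_lt ?_
    have h := hN n hn x hx
    rw [dist_comm, Real.dist_eq] at h
    have e : f ((φ ∘ θ) n) x - (G x - -a) = g (φ (θ n)) x - G x := by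
      simp only [g, Function.comp_apply]
      ring
    rw [e]
    exact h
end
end

section
/- Let ω be a domain in ℝ² whose convex hull is not all of ℝ², and let n ≥ 1. Then ω is n-Brody-hyperbolic if and only if ω contains no affine line of ℝ². -/
open Filter Topology Metric

noncomputable section

open MeasureTheory

lemma bh_comb {m : ℕ} {f g : E m → ℝ} (hf : HarmOn Set.univ f) (hg : HarmOn Set.univ g)
    (a b c : ℝ) : HarmOn Set.univ (fun x => a * f x + b * g x + c) := by
  obtain ⟨hf1, hf2⟩ := hf
  obtain ⟨hg1, hg2⟩ := hg
  rw [contDiffOn_univ] at hf1 hg1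
  refine ⟨?_, ?_⟩
  · rw [contDiffOn_univ]
    fun_prop
  · intro x hx
    have hfd : Differentiable ℝ f := hf1.differentiable (by norm_num)
    have hgd : Differentiable ℝ g := hg1.differentiable (by norm_num)
    have hfder : Differentiable ℝ (fderiv ℝ f) :=
      (hf1.fderiv_right (m := 1) (by norm_num)).differentiable (by norm_num)
    have hgder : Differentiable ℝ (fderiv ℝ g) :=
      (hg1.fderiv_right (m := 1) (by norm_num)).differentiable (by norm_num)
    have h1 : ∀ y v, fderiv ℝ (fun x => a * f x + b * g x + c) y v
        = a * fderiv ℝ f y v + b * fderiv ℝ g y v := by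
      intro y v
      have := (((hfd y).hasFDerivAt.const_mul a).add ((hgd y).hasFDerivAt.const_mul b)).add_const c
      have h2 := this.fderiv
      rw [show fderiv ℝ (fun x => a * f x + b * g x + c) y = _ from h2]
      simp
    have h3 : ∀ v, fderiv ℝ (fun y => a * fderiv ℝ f y v + b * fderiv ℝ g y v) x v
        = a * fderiv ℝ (fun y => fderiv ℝ f y v) x v
          + b * fderiv ℝ (fun y => fderiv ℝ g y v) x v := by
      intro v
      have e1 : DifferentiableAt ℝ (fun y => fderiv ℝ f y v) x := by fun_prop
      have e2 : DifferentiableAt ℝ (fun y => fderiv ℝ g y v) x := by fun_prop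
      have := ((e1.hasFDerivAt.const_mul a).add (e2.hasFDerivAt.const_mul b))
      have h2 := this.fderiv
      rw [show fderiv ℝ (fun y => a * fderiv ℝ f y v + b * fderiv ℝ g y v) x = _ from h2]
      simp
    have hfx := hf2 x hx
    have hgx := hg2 x hx
    unfold lap at *
    simp only [h1, h3]
    rw [Finset.sum_add_distrib, ← Finset.mul_sum, ← Finset.mul_sum, hfx, hgx]
    simp

/-- the weight -/
def bhφ {m : ℕ} (y : E m) : ℝ := max 0 (1 - ‖y‖ ^ 2)
/-- a radial potential of the weight -/
def bhψ {m : ℕ} (y : E m) : ℝ := (max 0 (1 - ‖y‖ ^ 2)) ^ 2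

lemma bhφ_cont {m : ℕ} : Continuous (bhφ (m := m)) := by unfold bhφ; fun_prop
lemma bhψ_cont {m : ℕ} : Continuous (bhψ (m := m)) := by unfold bhψ; fun_prop

lemma bhφ_zero {m : ℕ} {y : E m} (h : 1 ≤ ‖y‖) : bhφ y = 0 := by
  unfold bhφ
  apply max_eq_left
  nlinarith

lemma bhφ_supp {m : ℕ} : HasCompactSupport (bhφ (m := m)) := by
  apply HasCompactSupport.intro (isCompact_closedBall 0 1)
  intro y hy
  apply bhφ_zero
  simp at hy
  exact hy.le

lemma bhψ_supp {m : ℕ} : HasCompactSupport (bhψ (m := m)) := by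
  apply HasCompactSupport.intro (isCompact_closedBall 0 1)
  intro y hy
  have : bhφ y = 0 := by
    apply bhφ_zero
    simp at hy
    exact hy.le
  unfold bhψ
  unfold bhφ at this
  rw [this]; norm_num

lemma bh_sq_deriv (s : ℝ) : HasDerivAt (fun s : ℝ => (max 0 s) ^ 2) (2 * max 0 s) s := by
  rcases lt_trichotomy s 0 with h | h | h
  · rw [max_eq_left h.le]
    have : HasDerivAt (fun _ : ℝ => (0:ℝ)) 0 s := hasDerivAt_const _ _
    simp only [mul_zero]
    apply this.congr_of_eventuallyEq
    filter_upwards [Iio_mem_nhds h] with t ht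
    rw [max_eq_left (le_of_lt ht)]; norm_num
  · subst h
    simp only [max_self, mul_zero]
    rw [hasDerivAt_iff_isLittleO]
    simp only [max_self, sub_zero, smul_zero]
    have h1 : (fun x : ℝ => (max 0 x) ^ 2 - 0 ^ 2) =O[𝓝 0] (fun x : ℝ => x ^ 2) := by
      apply Asymptotics.IsBigO.of_bound 1
      filter_upwards with x
      simp only [norm_pow, Real.norm_eq_abs, one_mul, ne_eq, OfNat.ofNat_ne_zero, not_false_eq_true,
        zero_pow, sub_zero]
      apply pow_le_pow_left₀ (abs_nonneg _)
      rcases le_total 0 x with hx | hx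
      · rw [max_eq_right hx]
      · rw [max_eq_left hx]; simp
    refine h1.trans_isLittleO ?_
    have := Asymptotics.isLittleO_pow_id (𝕜 := ℝ) (n := 2) (by norm_num)
    exact this
  · rw [max_eq_right h.le]
    have : HasDerivAt (fun s : ℝ => s ^ 2) (2 * s) s := by
      simpa using hasDerivAt_pow 2 s
    apply this.congr_of_eventuallyEq
    filter_upwards [Ioi_mem_nhds h] with t ht
    rw [max_eq_right (le_of_lt ht)]

lemma bhψ_fderiv {m : ℕ} (y : E m) :
    HasFDerivAt (bhψ (m := m)) ((-4 * bhφ y) • (innerSL ℝ y)) y := by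
  have h1 : HasFDerivAt (fun y : E m => 1 - ‖y‖ ^ 2) (-(2 • (innerSL ℝ y))) y :=
    (hasStrictFDerivAt_norm_sq y).hasFDerivAt.const_sub 1
  have h2 := (bh_sq_deriv (1 - ‖y‖ ^ 2)).comp_hasFDerivAt y h1
  have h3 : (-4 * bhφ y) • (innerSL ℝ y) =
    (2 * max 0 (1 - ‖y‖ ^ 2)) • (-(2 • (innerSL ℝ y)) : E m →L[ℝ] ℝ) := by
    ext v
    simp [bhφ]; ring
  rw [h3]
  exact h2

lemma bhψ_partial {m : ℕ} (y : E m) (i : Fin m) :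
    fderiv ℝ (bhψ (m := m)) y (EuclideanSpace.single i 1) = -4 * bhφ y * y i := by
  rw [(bhψ_fderiv y).fderiv]
  simp [EuclideanSpace.inner_single_right]

lemma bh_parts {m : ℕ} {f : E m → ℝ} (hf : HarmOn Set.univ f) (x : E m) (t : ℝ) :
    ∫ y, fderiv ℝ f (x + t • y) y * bhφ y = 0 := by
  obtain ⟨hf1, hf2⟩ := hf
  rw [contDiffOn_univ] at hf1
  have hfd : Differentiable ℝ f := hf1.differentiable (by norm_num)
  have hfd1 : ContDiff ℝ 1 (fderiv ℝ f) := hf1.fderiv_right (m := 1) (by norm_num)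
  have hfder : Differentiable ℝ (fderiv ℝ f) := hfd1.differentiable (by norm_num)
  have hfdc : Continuous (fderiv ℝ f) := hfd1.continuous
  have hfddc : Continuous (fderiv ℝ (fderiv ℝ f)) := hfd1.continuous_fderiv (by norm_num)
  let e : Fin m → E m := fun i => EuclideanSpace.single i 1
  let g : Fin m → E m → ℝ := fun i y => fderiv ℝ f (x + t • y) (e i)
  let D : Fin m → E m → ℝ := fun i y => fderiv ℝ (fun z => fderiv ℝ f z (e i)) y (e i)
  have hD : ∀ i y, D i y = fderiv ℝ (fderiv ℝ f) y (e i) (e i) := by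
    intro i y
    simp only [D]
    rw [fderiv_clm_apply (hfder y) (by fun_prop)]
    simp
  have hDc : ∀ i, Continuous (D i) := by
    intro i
    have : D i = fun y => fderiv ℝ (fderiv ℝ f) y (e i) (e i) := funext (hD i)
    rw [this]; fun_prop
  have hgd : ∀ i, Differentiable ℝ (g i) := by
    intro i; simp only [g]; fun_prop
  have hgc : ∀ i, Continuous (g i) := fun i => (hgd i).continuous
  have hgder : ∀ i y, fderiv ℝ (g i) y (e i) = t * D i (x + t • y) := by
    intro i y
    have h1 : HasFDerivAt (fun y : E m => x + t • y) (t • ContinuousLinearMap.id ℝ (E m)) y :=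
      ((hasFDerivAt_id y).const_smul t).const_add x
    have h2 : DifferentiableAt ℝ (fun z => fderiv ℝ f z (e i)) (x + t • y) := by fun_prop
    have h3 := (h2.hasFDerivAt.comp y h1).fderiv
    rw [show fderiv ℝ (g i) y = _ from h3]
    simp [D]
  have hparts : ∀ i, ∫ y, g i y * (-4 * bhφ y * y i) = - ∫ y, t * D i (x + t • y) * bhψ y := by
    intro i
    have := integral_mul_fderiv_eq_neg_fderiv_mul_of_integrable (μ := (volume : Measure (E m)))
      (f := g i) (g := bhψ) (v := e i) ?_ ?_ ?_ (fun y _ => hgd i y)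
      (fun y _ => (bhψ_fderiv y).differentiableAt)
    · simpa only [hgder, e, bhψ_partial] using this
    · simp only [hgder]
      apply Continuous.integrable_of_hasCompactSupport
      · have := hDc i
        have := bhψ_cont (m := m)
        fun_prop
      · exact bhψ_supp.mul_left
    · simp only [e, bhψ_partial]
      apply Continuous.integrable_of_hasCompactSupport
      · have := hgc i
        have := bhφ_cont (m := m)
        fun_prop
      · exact (bhφ_supp.mul_left.mul_right).mul_left
    · apply Continuous.integrable_of_hasCompactSupport
      · have := hgc i
        have := bhψ_cont (m := m)
        fun_prop
      · exact bhψ_supp.mul_left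
  have hexp : ∀ y, fderiv ℝ f (x + t • y) y * bhφ y
      = ∑ i, (-1/4) * (g i y * (-4 * bhφ y * y i)) := by
    intro y
    have hy : y = ∑ i, y i • e i := by
      have := (EuclideanSpace.basisFun (Fin m) ℝ).sum_repr y
      simpa [e] using this.symm
    have : fderiv ℝ f (x + t • y) y = ∑ i, y i * g i y := by
      conv_lhs => rw [hy, map_sum]
      apply Finset.sum_congr rfl
      intro i _
      rw [← hy]
      simp [g]
    rw [this, Finset.sum_mul]
    apply Finset.sum_congr rfl
    intro i _
    ring
  simp only [hexp]
  rw [integral_finsetSum]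
  · simp only [integral_const_mul, hparts]
    rw [← Finset.mul_sum, Finset.sum_neg_distrib, ← integral_finsetSum]
    · have : ∀ y, ∑ i, t * D i (x + t • y) * bhψ y = 0 := by
        intro y
        have := hf2 (x + t • y) trivial
        unfold lap at this
        rw [← Finset.sum_mul, ← Finset.mul_sum]
        simp only [D, e]
        rw [this]; simp
      simp [this]
    · intro i _
      apply Continuous.integrable_of_hasCompactSupport
      · have := hDc i
        have := bhψ_cont (m := m)
        fun_prop
      · exact bhψ_supp.mul_left
  · intro i _
    apply Continuous.integrable_of_hasCompactSupport
    · have := hgc i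
      have := bhφ_cont (m := m)
      fun_prop
    · exact ((bhφ_supp.mul_left.mul_right).mul_left).mul_left

lemma bh_mean {m : ℕ} {f : E m → ℝ} (hf : HarmOn Set.univ f) (x : E m) (R : ℝ) :
    ∫ y, f (x + R • y) * bhφ y = f x * ∫ y : E m, bhφ y := by
  have hf1 := hf.1
  rw [contDiffOn_univ] at hf1
  have hfd : Differentiable ℝ f := hf1.differentiable (by norm_num)
  have hfc := hfd.continuous
  have hfdc : Continuous (fderiv ℝ f) := hf1.continuous_fderiv (by norm_num)
  have hφc := bhφ_cont (m := m)
  have key : ∀ t : ℝ, HasDerivAt (fun t : ℝ => ∫ y, f (x + t • y) * bhφ y) 0 t := by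
    intro t
    obtain ⟨C, hC⟩ := (isCompact_closedBall x (|t| + 1)).exists_bound_of_continuousOn
      hfdc.continuousOn
    have := hasDerivAt_integral_of_dominated_loc_of_deriv_le (μ := (volume : Measure (E m)))
      (F := fun t y => f (x + t • y) * bhφ y)
      (F' := fun t y => fderiv ℝ f (x + t • y) y * bhφ y)
      (bound := fun y => C * bhφ y) (x₀ := t) (s := Metric.ball t 1)
      (Metric.ball_mem_nhds t one_pos) ?_ ?_ ?_ ?_ ?_ ?_
    · have h2 := this.2
      simp only [bh_parts hf] at h2
      exact h2
    · filter_upwards with s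
      apply Continuous.aestronglyMeasurable
      fun_prop
    · apply Continuous.integrable_of_hasCompactSupport
      · fun_prop
      · exact bhφ_supp.mul_left
    · apply Continuous.aestronglyMeasurable
      fun_prop
    · filter_upwards with y s hs
      by_cases hy : 1 ≤ ‖y‖
      · rw [bhφ_zero hy]; simp
      · push Not at hy
        have hφ0 : 0 ≤ bhφ y := le_max_left _ _
        rw [norm_mul, Real.norm_of_nonneg hφ0]
        apply mul_le_mul_of_nonneg_right _ hφ0
        have hsabs : |s| ≤ |t| + 1 := by
          rw [Metric.mem_ball, Real.dist_eq] at hs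
          have := abs_sub_abs_le_abs_sub s t
          linarith
        have hmem : x + s • y ∈ Metric.closedBall x (|t| + 1) := by
          rw [Metric.mem_closedBall, dist_eq_norm, add_sub_cancel_left, norm_smul, Real.norm_eq_abs]
          nlinarith [abs_nonneg s, norm_nonneg y]
        have h3 := hC _ hmem
        calc ‖fderiv ℝ f (x + s • y) y‖ ≤ ‖fderiv ℝ f (x + s • y)‖ * ‖y‖ :=
              ContinuousLinearMap.le_opNorm _ _
          _ ≤ C := by nlinarith [norm_nonneg (fderiv ℝ f (x + s • y)), norm_nonneg y]
    · apply Continuous.integrable_of_hasCompactSupport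
      · fun_prop
      · exact bhφ_supp.mul_left
    · filter_upwards with y s hs
      have h1 : HasDerivAt (fun s : ℝ => x + s • y) y s := by
        simpa using ((hasDerivAt_id s).smul_const y).const_add x
      exact ((hfd _).hasFDerivAt.comp_hasDerivAt s h1).mul_const _
  have h := is_const_of_deriv_eq_zero (fun t => (key t).differentiableAt) (fun t => (key t).deriv) R 0
  simp only [zero_smul, add_zero] at h
  rw [h, integral_const_mul]

lemma bh_mean_scaled {m : ℕ} {f : E m → ℝ} (hf : HarmOn Set.univ f) (x : E m) {R : ℝ} (hR : 0 < R) :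
    ∫ u, f u * bhφ (R⁻¹ • (u - x)) = R ^ m * (f x * ∫ y : E m, bhφ y) := by
  rw [← bh_mean hf x R]
  have h1 := integral_add_left_eq_self (μ := (volume : Measure (E m)))
    (fun u => f u * bhφ (R⁻¹ • (u - x))) x
  rw [← h1]
  have h2 := Measure.integral_comp_smul (volume : Measure (E m))
    (fun u => f (x + u) * bhφ (R⁻¹ • (x + u - x))) R
  have h3 : ∀ y : E m, R⁻¹ • (x + R • y - x) = y := by
    intro y
    rw [add_sub_cancel_left, smul_smul, inv_mul_cancel₀ hR.ne', one_smul]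
  simp only [h3] at h2
  rw [h2]
  simp only [finrank_euclideanSpace, Fintype.card_fin, smul_eq_mul]
  rw [abs_of_pos (by positivity), ← mul_assoc, mul_inv_cancel₀ (by positivity), one_mul]

lemma bhφ_cmp {m : ℕ} (x z u : E m) {R : ℝ} (hR : 0 < R) :
    bhφ (R⁻¹ • (u - x)) ≤ (R + ‖x - z‖) / R * bhφ ((R + ‖x - z‖)⁻¹ • (u - z)) := by
  set d := ‖x - z‖ with hd
  have hd0 : 0 ≤ d := norm_nonneg _
  have hφ0 : 0 ≤ bhφ ((R + d)⁻¹ • (u - z)) := le_max_left _ _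
  conv_lhs => unfold bhφ
  apply max_le (by positivity)
  by_cases hr : R ≤ ‖u - x‖
  · have : 1 ≤ ‖R⁻¹ • (u - x)‖ := by
      rw [norm_smul, norm_inv, Real.norm_of_nonneg hR.le, inv_mul_eq_div, le_div_iff₀ hR]
      linarith
    have h2 : 0 ≤ (R + d) / R * bhφ ((R + d)⁻¹ • (u - z)) := by positivity
    nlinarith
  · push Not at hr
    have h1 : 1 - ‖(R + d)⁻¹ • (u - z)‖ ^ 2 ≤ bhφ ((R + d)⁻¹ • (u - z)) := le_max_right _ _
    have htri : ‖u - z‖ ≤ ‖u - x‖ + d := by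
      have := norm_add_le (u - x) (x - z)
      simpa using this
    refine le_trans ?_ (mul_le_mul_of_nonneg_left h1 (by positivity))
    have hRd : 0 < R + d := by linarith
    rw [norm_smul, norm_smul, norm_inv, norm_inv, Real.norm_of_nonneg hR.le,
      Real.norm_of_nonneg hRd.le]
    set r := ‖u - x‖ with hrr
    have hr0 : 0 ≤ r := norm_nonneg _
    have h5 : ((R + d)⁻¹ * ‖u - z‖) ^ 2 ≤ ((R + d)⁻¹ * (r + d)) ^ 2 := by
      gcongr
    have h6 : 1 - (R⁻¹ * r) ^ 2 ≤ (R + d) / R * (1 - ((R + d)⁻¹ * (r + d)) ^ 2) := by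
      have e : (R + d) / R * (1 - ((R + d)⁻¹ * (r + d)) ^ 2) - (1 - (R⁻¹ * r) ^ 2)
          = (R - r) ^ 2 * d / (R ^ 2 * (R + d)) := by
        field_simp
        ring
      have : 0 ≤ (R - r) ^ 2 * d / (R ^ 2 * (R + d)) := by positivity
      linarith
    refine h6.trans ?_
    gcongr

lemma bhφ_int_pos {m : ℕ} : 0 < ∫ y : E m, bhφ y := by
  apply Continuous.integral_pos_of_hasCompactSupport_nonneg_nonzero bhφ_cont bhφ_supp
    (fun y => le_max_left _ _) (x := 0)
  simp [bhφ]

lemma bh_le {m : ℕ} {f : E m → ℝ} (hf : HarmOn Set.univ f) (h0 : ∀ x, 0 ≤ f x) (x z : E m) :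
    f x ≤ f z := by
  have hfc : Continuous f := by
    have := hf.1
    rw [contDiffOn_univ] at this
    exact this.continuous
  have hφc := bhφ_cont (m := m)
  set d := ‖x - z‖ with hd
  have hd0 : 0 ≤ d := norm_nonneg _
  have hI := bhφ_int_pos (m := m)
  have hint : ∀ (w : E m) (S : ℝ), 0 < S → Integrable (fun u => f u * bhφ (S⁻¹ • (u - w))) := by
    intro w S hS
    apply Continuous.integrable_of_hasCompactSupport
    · fun_prop
    · apply HasCompactSupport.mul_left
      apply HasCompactSupport.intro (isCompact_closedBall w S)
      intro u hu
      apply bhφ_zero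
      rw [Metric.mem_closedBall, dist_eq_norm] at hu
      push Not at hu
      rw [norm_smul, norm_inv, Real.norm_of_nonneg hS.le, inv_mul_eq_div, le_div_iff₀ hS]
      linarith
  have hmain : ∀ R : ℝ, 0 < R → f x ≤ (1 + d / R) ^ (m + 1) * f z := by
    intro R hR
    have hRd : 0 < R + d := by linarith
    have h1 : ∫ u, f u * bhφ (R⁻¹ • (u - x))
        ≤ ∫ u, (R + d) / R * (f u * bhφ ((R + d)⁻¹ • (u - z))) := by
      apply integral_mono (hint x R hR) ((hint z (R + d) hRd).const_mul _)
      intro u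
      have := mul_le_mul_of_nonneg_left (bhφ_cmp x z u hR) (h0 u)
      simp only
      rw [← hd] at this
      linarith
    rw [integral_const_mul, bh_mean_scaled hf x hR, bh_mean_scaled hf z hRd] at h1
    have e1 : 1 + d / R = (R + d) / R := by field_simp
    rw [e1]
    have e2 : (R + d) / R * ((R + d) ^ m * (f z * ∫ y : E m, bhφ y))
       = R ^ m * (((R + d) / R) ^ (m + 1) * f z * ∫ y : E m, bhφ y) := by
      rw [div_pow]; field_simp; ring
    rw [e2] at h1
    have h3 := le_of_mul_le_mul_left h1 (by positivity)
    exact le_of_mul_le_mul_right h3 hI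
  have hlim : Tendsto (fun R : ℝ => (1 + d / R) ^ (m + 1) * f z) atTop (𝓝 ((1 + 0) ^ (m + 1) * f z)) :=
    (((tendsto_const_nhds.div_atTop tendsto_id).const_add 1).pow _).mul_const _
  have := ge_of_tendsto hlim (by
    filter_upwards [eventually_gt_atTop 0] with R hR using hmain R hR)
  simpa using this

lemma bh_liouville {m : ℕ} {f : E m → ℝ} (hf : HarmOn Set.univ f) (a c : ℝ) (ha : a ≠ 0)
    (h0 : ∀ x, 0 ≤ a * f x + c) (x z : E m) : f x = f z := by
  have h := bh_comb hf hf a 0 c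
  simp only [zero_mul, add_zero] at h
  have h1 := bh_le h h0 x z
  have h2 := bh_le h h0 z x
  have : a * f x = a * f z := by linarith
  exact mul_left_cancel₀ ha this

lemma bh_affine {m : ℕ} (i : Fin m) (a v : ℝ) : HarmOn Set.univ (fun x : E m => a + x i * v) := by
  refine ⟨by rw [contDiffOn_univ]; fun_prop, ?_⟩
  intro x _
  unfold lap
  apply Finset.sum_eq_zero
  intro j _
  have : ∀ y : E m, fderiv ℝ (fun x : E m => a + x i * v) y
      = v • (EuclideanSpace.proj i : E m →L[ℝ] ℝ) := by
    intro y
    have h := (((EuclideanSpace.proj i : E m →L[ℝ] ℝ).hasFDerivAt (x := y)).mul_const v).const_add a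
    exact h.fderiv
  simp only [this]
  simp

theorem stmt15 (ω : Set (E 2)) (hωo : IsOpen ω) (hωc : IsConnected ω)
    (hconv : convexHull ℝ ω ≠ Set.univ) (n : ℕ) (hn : 1 ≤ n) :
    (∀ F : E n → E 2, (∀ i, HarmOn Set.univ (fun x => F x i)) →
        (∀ x, F x ∈ ω) → ∀ x y : E n, F x = F y) ↔
      ¬ ∃ (a v : E 2), v ≠ 0 ∧ ∀ t : ℝ, a + t • v ∈ ω := by
  constructor
  · rintro h ⟨a, v, hv, hline⟩
    let i0 : Fin n := ⟨0, hn⟩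
    have := h (fun x => a + x i0 • v) (fun i => by simpa using bh_affine i0 (a i) (v i))
      (fun x => hline _) 0 (EuclideanSpace.single i0 1)
    simp at this
    exact hv this
  · intro hno F hF hFω x y
    by_contra hxy
    apply hno
    obtain ⟨p, hp⟩ := (Set.ne_univ_iff_exists_notMem _).1 hconv
    obtain ⟨l, hl⟩ := geometric_hahn_banach_open_point (convex_convexHull ℝ ω) hωo.convexHull hp
    set A := l (EuclideanSpace.single 0 1) with hA
    set B := l (EuclideanSpace.single 1 1) with hB
    have hlc : ∀ w : E 2, l w = A * w 0 + B * w 1 := by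
      intro w
      have hw : w = w 0 • EuclideanSpace.single 0 1 + w 1 • EuclideanSpace.single 1 1 := by
        ext i; fin_cases i <;> simp
      conv_lhs => rw [hw]
      rw [map_add, map_smul, map_smul, smul_eq_mul, smul_eq_mul]
      ring
    have hlF : ∀ z, A * F z 0 + B * F z 1 < l p := fun z => by
      rw [← hlc]; exact hl _ (subset_convexHull ℝ ω (hFω z))
    have hAB : 0 < A ^ 2 + B ^ 2 := by
      by_contra hcon
      have hA0 : A = 0 := by nlinarith [sq_nonneg A, sq_nonneg B]
      have hB0 : B = 0 := by nlinarith [sq_nonneg A, sq_nonneg B]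
      have := hlF x
      rw [hlc p, hA0, hB0] at this
      simp at this
    have hh1 := bh_comb (hF 0) (hF 1) A B 0
    have hh2 := bh_comb (hF 0) (hF 1) (-B) A 0
    have hc1 : ∀ z w, A * F z 0 + B * F z 1 + 0 = A * F w 0 + B * F w 1 + 0 :=
      bh_liouville hh1 (-1) (l p) (by norm_num) (fun z => by have := hlF z; linarith)
    have hinj : ∀ s t : E 2, A * s 0 + B * s 1 = A * t 0 + B * t 1 →
        -B * s 0 + A * s 1 = -B * t 0 + A * t 1 → s = t := by
      intro s t h1 h2
      have e0 : (A ^ 2 + B ^ 2) * s 0 = (A ^ 2 + B ^ 2) * t 0 := by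
        linear_combination A * h1 - B * h2
      have e1 : (A ^ 2 + B ^ 2) * s 1 = (A ^ 2 + B ^ 2) * t 1 := by
        linear_combination B * h1 + A * h2
      ext i
      fin_cases i
      · exact mul_left_cancel₀ hAB.ne' e0
      · exact mul_left_cancel₀ hAB.ne' e1
    have hne : -B * F x 0 + A * F x 1 + 0 ≠ -B * F y 0 + A * F y 1 + 0 := by
      intro h
      exact hxy (hinj _ _ (by have := hc1 x y; linarith) (by linarith))
    have hcont : Continuous (fun z => -B * F z 0 + A * F z 1 + 0) := by
      have := hh2.1
      rw [contDiffOn_univ] at this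
      exact this.continuous
    have hsurj : ∀ s : ℝ, ∃ z, -B * F z 0 + A * F z 1 + 0 = s := by
      intro s
      have hlo : ∃ z, -B * F z 0 + A * F z 1 + 0 ≤ s := by
        by_contra hcon
        push Not at hcon
        exact hne (bh_liouville hh2 1 (-s) (by norm_num) (fun z => by have := hcon z; linarith) x y)
      have hhi : ∃ z, s ≤ -B * F z 0 + A * F z 1 + 0 := by
        by_contra hcon
        push Not at hcon
        exact hne (bh_liouville hh2 (-1) s (by norm_num) (fun z => by have := hcon z; linarith) x y)
      exact mem_range_of_exists_le_of_exists_ge hcont hlo hhi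
    refine ⟨F x, !₂[-B, A], ?_, ?_⟩
    · intro h
      have h0 := congrArg (fun w : E 2 => w 0) h
      have h1 := congrArg (fun w : E 2 => w 1) h
      simp at h0 h1
      rw [h0, h1] at hAB
      norm_num at hAB
    · intro t
      obtain ⟨z, hz⟩ := hsurj (-B * (F x + t • !₂[-B, A] : E 2) 0 + A * (F x + t • !₂[-B, A] : E 2) 1)
      have : F x + t • !₂[-B, A] = F z := by
        apply hinj
        · have := hc1 x z
          simp
          linarith
        · linarith
      rw [this]
      exact hFω z
end
end
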